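/- Let u belong to F(p,rho) and v belong to F(p,rho'). If rho < rho', then m_u <= m_v; in particular m^rho_{p} <= m^{rho'}_{p}. Consequently, m_{p} = mbar: the minimal Castelnuovo-Mumford regularity over all closed projective subschemes with Hilbert polynomial p(z) equals the minimal Castelnuovo-Mumford regularity of schemes with Hilbert function fbar = f^{rhobar_{p}}_{p}. -/

import Mathlib

open scoped Classical

noncomputable section

/-! ## Binomial expansions and the Macaulay operations `(a_t)^+_+` and `(a_t)^-_-` -/

/-- The largest `k` such that `C(k,t) ≤ a` (top coefficient of the greedy binomial
expansion of `a` in base `t`). -/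
def expTop (a t : ℕ) : ℕ := Nat.findGreatest (fun k => Nat.choose k t ≤ a) (a + t + 1)

/-- `(a_t)^+_+` : if `a = C(k(t),t) + ... + C(k(j),j)` is the binomial expansion of `a`
in base `t`, then `plusPlus a t = C(k(t)+1,t+1) + ... + C(k(j)+1,j+1)`; it sends `0` to `0`. -/
def plusPlus : ℕ → ℕ → ℕ
  | _, 0 => 0
  | a, t + 1 =>
    if a = 0 then 0
    else Nat.choose (expTop a (t + 1) + 1) (t + 2) +
      plusPlus (a - Nat.choose (expTop a (t + 1)) (t + 1)) t

/-- `(a_t)^-_-` : if `a = C(k(t),t) + ... + C(k(j),j)` is the binomial expansion of `a`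
in base `t`, then `minusMinus a t = C(k(t)-1,t-1) + ... + C(k(j)-1,j-1)`; it sends `0` to `0`. -/
def minusMinus : ℕ → ℕ → ℕ
  | _, 0 => 0
  | a, t + 1 =>
    if a = 0 then 0
    else Nat.choose (expTop a (t + 1) - 1) t +
      minusMinus (a - Nat.choose (expTop a (t + 1)) (t + 1)) t

/-! ## Numerical functions -/

/-- A numerical function (modelled with values in `ℤ`) is *admissible* (an O-sequence) if it is
nonnegative, `H 0 = 1` and `H (t+1) ≤ (H(t)_t)^+_+` for every `t ≥ 1`. -/
def OSeq (H : ℕ → ℤ) : Prop :=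
  (∀ t, 0 ≤ H t) ∧ H 0 = 1 ∧ ∀ t, 1 ≤ t → H (t + 1) ≤ (plusPlus (H t).toNat t : ℤ)

/-- First derivative of a numerical function: `Δf(0) = 1`, `Δf(t) = f(t) - f(t-1)`. -/
def nderiv (f : ℕ → ℤ) : ℕ → ℤ
  | 0 => 1
  | t + 1 => f (t + 1) - f t

/-- Integral of a numerical function: `Σg(0) = 1`, `Σg(t) = Σg(t-1) + g(t)`. -/
def ninteg (g : ℕ → ℤ) : ℕ → ℤ
  | 0 => 1
  | t + 1 => ninteg g t + g (t + 1)

/-! ## Admissible Hilbert polynomials in Gotzmann form -/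

/-- The integer-valued binomial coefficient `C(a,k)` for `a : ℤ`, agreeing with the
polynomial binomial coefficient `a(a-1)⋯(a-k+1)/k!`. -/
def zchoose (a : ℤ) (k : ℕ) : ℤ :=
  if 0 ≤ a then (a.toNat.choose k : ℤ)
  else (-1) ^ k * (((k : ℤ) - 1 - a).toNat.choose k : ℤ)

/-- An admissible Hilbert polynomial, recorded through its Gotzmann form
`p(z) = C(z+k₁,k₁) + C(z+k₂-1,k₂) + ... + C(z+k_r-(r-1),k_r)` with `k₁ ≥ k₂ ≥ ... ≥ k_r ≥ 0`. -/
structure GotzmannPoly where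
  ks : List ℕ
  sorted : ks.Pairwise (· ≥ ·)

namespace GotzmannPoly

/-- The Gotzmann number `r` of `p`. -/
def r (p : GotzmannPoly) : ℕ := p.ks.length

/-- The degree of `p`, namely `k₁`. -/
def degree (p : GotzmannPoly) : ℕ := p.ks.headD 0

/-- Evaluation of `p` at an integer. -/
def eval (p : GotzmannPoly) (z : ℤ) : ℤ :=
  ∑ i ∈ Finset.range p.r, zchoose (z + (p.ks.getD i 0 : ℤ) - i) (p.ks.getD i 0)

/-- The first difference `Δp(z) = p(z) - p(z-1)`, in Gotzmann form. -/
def delta (p : GotzmannPoly) : GotzmannPoly where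
  ks := (p.ks.filter fun k => 1 ≤ k).map fun k => k - 1
  sorted := by
    refine List.Pairwise.map _ (fun {a b} h => Nat.sub_le_sub_right h 1) ?_
    exact p.sorted.filter _

/-- Iterated first difference `Δ^i p`. -/
def deltaIter (p : GotzmannPoly) (i : ℕ) : GotzmannPoly := delta^[i] p

/-- The polynomial `p(z) + c`, in Gotzmann form. -/
def addConst (p : GotzmannPoly) (c : ℕ) : GotzmannPoly where
  ks := p.ks ++ List.replicate c 0
  sorted := by
    rw [List.pairwise_append]
    refine ⟨p.sorted, ?_, ?_⟩
    · exact List.pairwise_replicate.2 (Or.inr le_rfl)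
    · intro a _ b hb
      rw [List.eq_of_mem_replicate hb]
      exact Nat.zero_le a

end GotzmannPoly

/-- The set `Π_p = {1 ≤ t ≤ r : (p(t+h)_{t+h})^+_+ ≥ p(t+h+1) ≥ 1 for all h ≥ 0}`. -/
def PiSet (p : GotzmannPoly) : Set ℕ :=
  {t | 1 ≤ t ∧ t ≤ p.r ∧ ∀ h : ℕ,
      p.eval ((t : ℤ) + (h : ℤ) + 1) ≤ (plusPlus (p.eval ((t : ℤ) + (h : ℤ))).toNat (t + h) : ℤ) ∧
      1 ≤ p.eval ((t : ℤ) + (h : ℤ) + 1)}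

/-- `ρ_p`: `0` if `min Π_p = 1` and `p(0) = 1`, and `min Π_p` otherwise. -/
def rhoP (p : GotzmannPoly) : ℕ :=
  if sInf (PiSet p) = 1 ∧ p.eval 0 = 1 then 0 else sInf (PiSet p)

/-- The minimal function `f^ρ_p` : `f(t) = p(t)` for `t ≥ ρ` and
`f(t) = ((f(t+1))_{t+1})^-_-` for `t < ρ`. -/
def fmin (p : GotzmannPoly) (ρ : ℕ) (t : ℕ) : ℤ :=
  if h : ρ ≤ t then p.eval (t : ℤ)
  else (minusMinus (fmin p ρ (t + 1)).toNat (t + 1) : ℤ)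
termination_by ρ - t
decreasing_by omega

/-- The function `g^ρ_p` : `g(t) = p(t)` for `t ≥ ρ`, `g(ρ-1) = p(ρ-1) + 1` and
`g(t) = ((g(t+1))_{t+1})^-_-` for `t < ρ-1`. -/
def gmin (p : GotzmannPoly) (ρ : ℕ) (t : ℕ) : ℤ :=
  if h : ρ ≤ t then p.eval (t : ℤ)
  else if t = ρ - 1 then p.eval (t : ℤ) + 1
  else (minusMinus (gmin p ρ (t + 1)).toNat (t + 1) : ℤ)
termination_by ρ - t
decreasing_by omega

/-- `H` has regularity `ρ` (with respect to the Hilbert polynomial `p`): `ρ` is the least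
integer such that `H(t) = p(t)` for all `t ≥ ρ`. -/
def IsRegOf (p : GotzmannPoly) (H : ℕ → ℤ) (ρ : ℕ) : Prop :=
  (∀ t : ℕ, ρ ≤ t → H t = p.eval (t : ℤ)) ∧
  ∀ ρ' : ℕ, (∀ t : ℕ, ρ' ≤ t → H t = p.eval (t : ℤ)) → ρ ≤ ρ'

/-- `H` has Hilbert polynomial `p`, i.e. eventually agrees with `p`. -/
def HasHP (p : GotzmannPoly) (H : ℕ → ℤ) : Prop :=
  ∃ N : ℕ, ∀ t : ℕ, N ≤ t → H t = p.eval (t : ℤ)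

/-- `F(p,ρ)`: the set of Hilbert functions of closed projective subschemes (i.e. numerical
functions which are admissible together with their first derivative) with Hilbert
polynomial `p` and regularity `ρ`. -/
def Fset (p : GotzmannPoly) (ρ : ℕ) : Set (ℕ → ℤ) :=
  {H | OSeq H ∧ OSeq (nderiv H) ∧ IsRegOf p H ρ}

/-- `ρ̄_p`: the minimal `ρ` such that `F(p,ρ)` is non-empty. -/
def rhobar (p : GotzmannPoly) : ℕ := sInf {ρ | (Fset p ρ).Nonempty}

/-! ## Monomial ideals in `K[x₀,…,xₙ]` (combinatorial model) -/

/-- Monomials of `K[x₀,…,xₙ]`, as exponent vectors. -/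
abbrev Mon (n : ℕ) := Fin (n + 1) → ℕ

/-- Degree of a monomial. -/
def mdeg {n : ℕ} (m : Mon n) : ℕ := ∑ i, m i

/-- `T_t`, the set of terms of degree `t`. -/
def Tset (n t : ℕ) : Set (Mon n) := {m | mdeg m = t}

/-- A set of monomials closed under multiplication by arbitrary monomials (a monomial ideal). -/
def MonIdeal {n : ℕ} (J : Set (Mon n)) : Prop :=
  ∀ m ∈ J, ∀ m' : Mon n, m + m' ∈ J

/-- The elementary Borel move sending `x^m` to `x_i · x^m / x_j`. -/
def borelStep {n : ℕ} (m : Mon n) (j i : Fin (n + 1)) : Mon n :=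
  fun l => if l = j then m l - 1 else if l = i then m l + 1 else m l

/-- One elementary Borel move `x_j ↦ x_i` with `j < i`. -/
def borelMove {n : ℕ} (a b : Mon n) : Prop :=
  ∃ j i : Fin (n + 1), j < i ∧ 1 ≤ a j ∧ b = borelStep a j i

/-- The Borel (partial) order `≤_B` on monomials. -/
def borelLE {n : ℕ} : Mon n → Mon n → Prop := Relation.ReflTransGen borelMove

/-- A strongly stable (Borel) monomial ideal. -/
def StronglyStable {n : ℕ} (J : Set (Mon n)) : Prop :=
  MonIdeal J ∧ ∀ m ∈ J, ∀ j i : Fin (n + 1), j < i → 1 ≤ m j → borelStep m j i ∈ J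

/-- A Borel set in `T_t`: a set of degree-`t` monomials closed upwards under `≤_B`. -/
def IsBorelSet {n : ℕ} (t : ℕ) (B : Set (Mon n)) : Prop :=
  B ⊆ Tset n t ∧ ∀ a ∈ B, ∀ b : Mon n, borelLE a b → b ∈ B

/-- Saturation of a monomial ideal:
`J^sat = {m : for every i there is k with x_i^k · m ∈ J}`. -/
def monSat {n : ℕ} (J : Set (Mon n)) : Set (Mon n) :=
  {m | ∀ i : Fin (n + 1), ∃ k : ℕ, (fun l => if l = i then m l + k else m l) ∈ J}

/-- The monomial ideal generated by a set of monomials. -/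
def genIdeal {n : ℕ} (B : Set (Mon n)) : Set (Mon n) :=
  {m | ∃ b ∈ B, ∃ c : Mon n, m = b + c}

/-- The Hilbert function of `S/J` for a monomial ideal `J`: the number of degree-`t`
monomials outside `J`. -/
def hilb {n : ℕ} (J : Set (Mon n)) (t : ℕ) : ℕ :=
  Set.ncard {m : Mon n | mdeg m = t ∧ m ∉ J}

/-- `m / x_i` as an exponent vector. -/
def shrinkAt {n : ℕ} (m : Mon n) (i : Fin (n + 1)) : Mon n :=
  fun l => if l = i then m l - 1 else m l

/-- `m` is a minimal (monomial) generator of the monomial ideal `J`. -/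
def IsMinGen {n : ℕ} (J : Set (Mon n)) (m : Mon n) : Prop :=
  m ∈ J ∧ ∀ i : Fin (n + 1), 1 ≤ m i → shrinkAt m i ∉ J

/-- The Castelnuovo–Mumford regularity of a strongly stable ideal: the maximal degree of a
minimal monomial generator. -/
def monReg {n : ℕ} (J : Set (Mon n)) : ℕ :=
  sSup {d | ∃ m : Mon n, IsMinGen J m ∧ mdeg m = d}

/-- `m_u`: the minimal Castelnuovo–Mumford regularity of a closed projective subscheme with
Hilbert function `u`, i.e. the minimum of `reg J` over all `n` and all saturated strongly
stable ideals `J ⊆ K[x₀,…,xₙ]` with `H_{S/J} = u`. -/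
def mReg (u : ℕ → ℤ) : ℕ :=
  sInf {r | ∃ (n : ℕ) (J : Set (Mon n)), StronglyStable J ∧ monSat J = J ∧
      (∀ t : ℕ, (hilb J t : ℤ) = u t) ∧ monReg J = r}

/-- `M(p,ρ) = {m_u : u ∈ F(p,ρ)}`. -/
def Mset (p : GotzmannPoly) (ρ : ℕ) : Set ℕ := {r | ∃ u ∈ Fset p ρ, mReg u = r}

/-- `m^ρ_p = min M(p,ρ)`. -/
def mRho (p : GotzmannPoly) (ρ : ℕ) : ℕ := sInf (Mset p ρ)

/-- `m_p`: the minimal Castelnuovo–Mumford regularity of schemes with Hilbert polynomial `p`. -/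
def mP (p : GotzmannPoly) : ℕ := sInf {r | ∃ ρ : ℕ, ∃ u ∈ Fset p ρ, mReg u = r}

/-! ## Lex segments and growth-height-lexicographic Borel sets -/

/-- `a` is smaller than `b` in the deglex order (for monomials of the same degree):
`a k < b k` where `k` is the largest index where they differ. -/
def deglexLT {n : ℕ} (a b : Mon n) : Prop :=
  ∃ k : Fin (n + 1), a k < b k ∧ ∀ l : Fin (n + 1), k < l → a l = b l

/-- A lex-segment of `T_t`: a set of degree-`t` monomials consisting of the highest terms
with respect to deglex. -/
def IsLexSeg {n : ℕ} (t : ℕ) (L : Set (Mon n)) : Prop :=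
  L ⊆ Tset n t ∧ ∀ a ∈ L, ∀ b ∈ Tset n t, deglexLT a b → b ∈ L

/-- A lex-segment in `A ⊆ T_t`: the intersection of a lex-segment of `T_t` with `A`. -/
def LexSegIn {n : ℕ} (t : ℕ) (A S : Set (Mon n)) : Prop :=
  ∃ L : Set (Mon n), IsLexSeg t L ∧ S = L ∩ A

/-- The growth class `B^{(i)} = {m ∈ B : min(m) = i}`. -/
def growthClass {n : ℕ} (B : Set (Mon n)) (i : Fin (n + 1)) : Set (Mon n) :=
  {m | m ∈ B ∧ 1 ≤ m i ∧ ∀ j : Fin (n + 1), j < i → m j = 0}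

/-- The height class `B(i) = {m ∈ B : the exponent of x₀ in m is i}`. -/
def heightClass {n : ℕ} (B : Set (Mon n)) (i : ℕ) : Set (Mon n) :=
  {m | m ∈ B ∧ m 0 = i}

/-- A Borel set `B ⊆ T_t` is growth-lexicographic if all its growth classes are lex-segments
in the corresponding growth classes of `T_t`. -/
def GrowthLex {n : ℕ} (t : ℕ) (B : Set (Mon n)) : Prop :=
  ∀ i : Fin (n + 1), LexSegIn t (growthClass (Tset n t) i) (growthClass B i)

/-- A Borel set `B ⊆ T_t` is growth-height-lexicographic if `B(0)` is growth-lexicographic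
and `B(i)` is a lex-segment in `T_t(i)` for every `0 < i ≤ t`. -/
def GHLex {n : ℕ} (t : ℕ) (B : Set (Mon n)) : Prop :=
  GrowthLex t (heightClass B 0) ∧
  ∀ i : ℕ, 0 < i → i ≤ t → LexSegIn t (heightClass (Tset n t) i) (heightClass B i)

end

/-! ### Arithmetic of binomial expansions -/

theorem le_choose_add {k t : ℕ} (ht : 1 ≤ t) (htk : t ≤ k) : k + 1 ≤ k.choose t + t := by
  obtain ⟨s, rfl⟩ : ∃ s, t = s + 1 := ⟨t - 1, by omega⟩
  induction k with
  | zero => omega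
  | succ k ih =>
    rcases Nat.lt_or_ge k (s + 1) with h | h
    · obtain rfl : k = s := by omega
      simp
    · have h1 := ih h
      have h2 : 0 < k.choose s := Nat.choose_pos (by omega)
      rw [Nat.choose_succ_succ']
      omega

theorem expTop_eq {a t k : ℕ} (ht : 1 ≤ t) (h1 : k.choose t ≤ a) (h2 : a < (k + 1).choose t) :
    expTop a t = k := by
  unfold expTop
  rw [Nat.findGreatest_eq_iff]
  refine ⟨?_, fun _ => h1, ?_⟩
  · rcases Nat.lt_or_ge k t with h | h
    · omega
    · have := le_choose_add ht h
      omega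
  · intro n hn _ hle
    have : (k + 1).choose t ≤ n.choose t := Nat.choose_le_choose t hn
    omega

theorem exists_binomial_top {a : ℕ} (ha : a ≠ 0) (t : ℕ) :
    ∃ k r, t ≤ k ∧ r < (k + 1).choose t ∧ a = (k + 1).choose (t + 1) + r := by
  have hex : ∃ m, a < (m + 1).choose (t + 1) := by
    refine ⟨a + t + 1, ?_⟩
    have := le_choose_add (k := a + t + 1 + 1) (t := t + 1) (by omega) (by omega)
    omega
  classical
  have hspec := Nat.find_spec hex
  have hmin := fun {m} => Nat.find_min hex (m := m)
  generalize Nat.find hex = m at hspec hmin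
  rcases Nat.lt_or_ge m (t + 1) with h | h
  · exfalso
    have : (m + 1).choose (t + 1) ≤ (t + 1).choose (t + 1) := Nat.choose_le_choose _ (by omega)
    simp at this
    omega
  · have h3 := hmin (m := m - 1) (by omega)
    obtain ⟨k, rfl⟩ : ∃ k, m = k + 1 := ⟨m - 1, by omega⟩
    simp only [Nat.add_sub_cancel, not_lt] at h3
    rw [Nat.choose_succ_succ' (k + 1) t] at hspec
    exact ⟨k, a - (k + 1).choose (t + 1), by omega, by omega, by omega⟩

theorem expTop_choose_add {k t r : ℕ} (hr : r < (k + 1).choose t) :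
    expTop ((k + 1).choose (t + 1) + r) (t + 1) = k + 1 := by
  apply expTop_eq (by omega) (by omega)
  rw [Nat.choose_succ_succ' (k + 1) t]
  omega

theorem minusMinus_choose_add {k t r : ℕ} (htk : t ≤ k) (hr : r < (k + 1).choose t) :
    minusMinus ((k + 1).choose (t + 1) + r) (t + 1) = k.choose t + minusMinus r t := by
  have h0 : 0 < (k + 1).choose (t + 1) := Nat.choose_pos (by omega)
  rw [minusMinus, if_neg (by omega), expTop_choose_add hr]
  simp

theorem plusPlus_choose_add {k t r : ℕ} (htk : t ≤ k) (hr : r < (k + 1).choose t) :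
    plusPlus ((k + 1).choose (t + 1) + r) (t + 1) = (k + 2).choose (t + 2) + plusPlus r t := by
  have h0 : 0 < (k + 1).choose (t + 1) := Nat.choose_pos (by omega)
  rw [plusPlus, if_neg (by omega), expTop_choose_add hr]
  simp

theorem minusMinus_zero (t : ℕ) : minusMinus 0 t = 0 := by
  cases t <;> simp [minusMinus]

theorem plusPlus_zero (t : ℕ) : plusPlus 0 t = 0 := by
  cases t <;> simp [plusPlus]

theorem minusMinus_choose {k t : ℕ} (htk : t ≤ k) :
    minusMinus ((k + 1).choose (t + 1)) (t + 1) = k.choose t := by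
  have := minusMinus_choose_add htk (r := 0) (Nat.choose_pos (by omega))
  simpa [minusMinus_zero] using this

theorem plusPlus_choose {k t : ℕ} (htk : t ≤ k) :
    plusPlus ((k + 1).choose (t + 1)) (t + 1) = (k + 2).choose (t + 2) := by
  have := plusPlus_choose_add htk (r := 0) (Nat.choose_pos (by omega))
  simpa [plusPlus_zero] using this

theorem minusMinus_one (t : ℕ) : minusMinus 1 (t + 1) = 1 := by
  have := minusMinus_choose (le_refl t)
  simpa using this

theorem minusMinus_mono (t : ℕ) : ∀ {a b : ℕ}, a ≤ b → minusMinus a t ≤ minusMinus b t := by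
  induction t with
  | zero => intro a b _; simp [minusMinus]
  | succ t ih =>
    intro a b hab
    rcases Nat.eq_zero_or_pos a with rfl | ha
    · simp [minusMinus_zero]
    obtain ⟨k, r, hk, hr, rfl⟩ := exists_binomial_top (a := a) (by omega) t
    obtain ⟨l, s, hl, hs, rfl⟩ := exists_binomial_top (a := b) (by omega) t
    rw [minusMinus_choose_add hk hr, minusMinus_choose_add hl hs]
    rcases lt_trichotomy k l with h | rfl | h
    · rcases t with _ | t
      · simp [minusMinus]
      · have h1 := ih hr.le
        rw [minusMinus_choose (by omega)] at h1
        have h2 : (k + 1).choose (t + 1) ≤ l.choose (t + 1) := Nat.choose_le_choose _ h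
        have h3 := Nat.choose_succ_succ' k t
        omega
    · have := ih (show r ≤ s by omega)
      omega
    · exfalso
      have h2 : (l + 2).choose (t + 1) ≤ (k + 1).choose (t + 1) :=
        Nat.choose_le_choose _ (by omega)
      have h3 : (l + 2).choose (t + 1) = (l + 1).choose t + (l + 1).choose (t + 1) :=
        Nat.choose_succ_succ' _ _
      omega

theorem plusPlus_succ_lt (t : ℕ) : ∀ {k a : ℕ}, t ≤ k → a < (k + 1).choose t →
    plusPlus a t + 1 < (k + 2).choose (t + 1) := by
  induction t with
  | zero => intro k a _ _; simp [plusPlus]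
  | succ t ih =>
    intro k a htk ha
    rcases Nat.eq_zero_or_pos a with rfl | ha0
    · have h1 : 0 < (k + 1).choose (t + 1) := Nat.choose_pos (by omega)
      have h2 : 0 < (k + 1).choose (t + 2) := Nat.choose_pos (by omega)
      have h3 : (k + 2).choose (t + 2) = (k + 1).choose (t + 1) + (k + 1).choose (t + 2) :=
        Nat.choose_succ_succ' _ _
      rw [plusPlus_zero]
      change 0 + 1 < (k + 2).choose (t + 2)
      omega
    · obtain ⟨j, r, hj, hr, rfl⟩ := exists_binomial_top (a := a) (by omega) t
      have hjk : j + 1 ≤ k := by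
        by_contra h
        have : (k + 1).choose (t + 1) ≤ (j + 1).choose (t + 1) :=
          Nat.choose_le_choose _ (by omega)
        omega
      rw [plusPlus_choose_add hj hr]
      have h1 := ih hj hr
      have h2 : (j + 3).choose (t + 2) ≤ (k + 2).choose (t + 2) :=
        Nat.choose_le_choose _ (by omega)
      have h3 : (j + 3).choose (t + 2) = (j + 2).choose (t + 1) + (j + 2).choose (t + 2) :=
        Nat.choose_succ_succ' _ _
      change _ < (k + 2).choose (t + 2)
      omega

theorem minusMinus_plusPlus_aux (t : ℕ) : ∀ {a : ℕ}, (t = 0 → a = 0) →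
    minusMinus (plusPlus a t) (t + 1) = a ∧ minusMinus (plusPlus a t + 1) (t + 1) = a + 1 := by
  induction t with
  | zero =>
    intro a ha
    obtain rfl := ha rfl
    simp [plusPlus, minusMinus_zero, minusMinus_one]
  | succ t ih =>
    intro a _
    rcases Nat.eq_zero_or_pos a with rfl | ha0
    · simp [plusPlus_zero, minusMinus_zero, minusMinus_one]
    · obtain ⟨j, r, hj, hr, rfl⟩ := exists_binomial_top (a := a) (by omega) t
      have hlt := plusPlus_succ_lt t hj hr
      obtain ⟨h1, h2⟩ := ih (a := r) (by rintro rfl; simpa using hr)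
      rw [plusPlus_choose_add hj hr, minusMinus_choose_add (by omega)
        (by change _ < (j + 2).choose (t + 1); omega),
        add_assoc,
        minusMinus_choose_add (by omega) hlt, h1, h2]
      exact ⟨rfl, rfl⟩

theorem le_plusPlus_iff {a b t : ℕ} (ht : 1 ≤ t) :
    b ≤ plusPlus a t ↔ minusMinus b (t + 1) ≤ a := by
  obtain ⟨h1, h2⟩ := minusMinus_plusPlus_aux t (a := a) (by omega)
  constructor
  · intro h
    have := minusMinus_mono (t + 1) h
    omega
  · intro h
    by_contra hlt
    have := minusMinus_mono (t + 1) (show plusPlus a t + 1 ≤ b by omega)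
    omega

theorem plusPlus_mono {a b t : ℕ} (ht : 1 ≤ t) (hab : a ≤ b) : plusPlus a t ≤ plusPlus b t := by
  rw [le_plusPlus_iff ht]
  exact ((le_plusPlus_iff ht).1 le_rfl).trans hab

/-! ### Monomials supported on the last variables, initial segments, Borel sets -/

/-- The monomial `x_l`. -/
def monX {n : ℕ} (l : Fin (n + 1)) : Mon n := Pi.single l 1

theorem monX_same {n : ℕ} (l : Fin (n + 1)) : monX l l = 1 := by simp [monX]

theorem monX_ne {n : ℕ} {l k : Fin (n + 1)} (h : k ≠ l) : monX l k = 0 := by simp [monX, h]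

theorem monX_apply {n : ℕ} (l k : Fin (n + 1)) : monX l k = if k = l then 1 else 0 := by
  simp [monX, Pi.single_apply]

theorem mdeg_add {n : ℕ} (a b : Mon n) : mdeg (a + b) = mdeg a + mdeg b := by
  simp [mdeg, Finset.sum_add_distrib]

theorem mdeg_monX {n : ℕ} (l : Fin (n + 1)) : mdeg (monX l) = 1 := by
  simp [mdeg, monX]

theorem mdeg_zero {n : ℕ} : mdeg (0 : Mon n) = 0 := by simp [mdeg]

theorem eq_zero_of_mdeg_eq_zero {n : ℕ} {m : Mon n} (h : mdeg m = 0) : m = 0 := by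
  funext l
  have := Finset.single_le_sum (f := m) (fun i _ => Nat.zero_le _) (Finset.mem_univ l)
  simp only [mdeg] at h
  simp only [Pi.zero_apply]
  omega

theorem exists_eq_add_monX {n : ℕ} {m : Mon n} {l : Fin (n + 1)} (h : 1 ≤ m l) :
    ∃ m', m = m' + monX l := by
  refine ⟨m - monX l, ?_⟩
  funext k
  simp only [Pi.add_apply, Pi.sub_apply, monX_apply]
  split_ifs with hk
  · subst hk; omega
  · omega

theorem exists_pos_of_mdeg_pos {n : ℕ} {m : Mon n} (h : 1 ≤ mdeg m) : ∃ l, 1 ≤ m l := by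
  by_contra hc
  push Not at hc
  have : m = 0 := by funext l; have := hc l; simp; omega
  rw [this, mdeg_zero] at h
  omega

/-- If `x_b m = x_a m'` with `a ≠ b`, then `x_b` divides `m'`. -/
theorem exists_common_of_add_monX_eq {n : ℕ} {m m' : Mon n} {a b : Fin (n + 1)} (hab : a ≠ b)
    (h : m + monX b = m' + monX a) : ∃ c, m' = c + monX b ∧ m = c + monX a := by
  have hb := congrFun h b
  simp only [Pi.add_apply, monX_same, monX_ne hab.symm] at hb
  obtain ⟨c, rfl⟩ := exists_eq_add_monX (m := m') (l := b) (by omega)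
  refine ⟨c, rfl, ?_⟩
  have : m + monX b = (c + monX a) + monX b := by rw [h]; abel
  exact add_right_cancel this

/-- The monomials of degree `d` in the variables `x_i, …, x_n`. -/
noncomputable def monsFrom (n i d : ℕ) : Finset (Mon n) :=
  (Finset.piAntidiag Finset.univ d).filter fun m => ∀ l : Fin (n + 1), l.val < i → m l = 0

theorem mem_monsFrom {n i d : ℕ} {m : Mon n} :
    m ∈ monsFrom n i d ↔ mdeg m = d ∧ ∀ l : Fin (n + 1), l.val < i → m l = 0 := by
  simp [monsFrom, mdeg]

theorem add_monX_mem_monsFrom {n i d : ℕ} {m : Mon n} {l : Fin (n + 1)} (hl : i ≤ l.val) :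
    m + monX l ∈ monsFrom n i (d + 1) ↔ m ∈ monsFrom n i d := by
  simp only [mem_monsFrom, mdeg_add, mdeg_monX, Pi.add_apply]
  constructor
  · rintro ⟨h1, h2⟩
    exact ⟨by omega, fun k hk => by have := h2 k hk; omega⟩
  · rintro ⟨h1, h2⟩
    refine ⟨by omega, fun k hk => ?_⟩
    rw [h2 k hk, monX_ne (by rintro rfl; omega)]

theorem monsFrom_mono {n i j d : ℕ} (h : i ≤ j) : monsFrom n j d ⊆ monsFrom n i d := by
  intro m hm
  rw [mem_monsFrom] at hm ⊢
  exact ⟨hm.1, fun l hl => hm.2 l (by omega)⟩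

theorem monsFrom_zero (n i : ℕ) : monsFrom n i 0 = {0} := by
  ext m
  rw [mem_monsFrom, Finset.mem_singleton]
  constructor
  · exact fun h => eq_zero_of_mdeg_eq_zero h.1
  · rintro rfl; simp [mdeg_zero]

theorem monsFrom_eq_empty {n i d : ℕ} (hi : n < i) (hd : 1 ≤ d) : monsFrom n i d = ∅ := by
  rw [Finset.eq_empty_iff_forall_notMem]
  intro m hm
  rw [mem_monsFrom] at hm
  obtain ⟨l, hl⟩ := exists_pos_of_mdeg_pos (m := m) (by omega)
  have := hm.2 l (by omega)
  omega

theorem mem_monsFrom_succ {n i d : ℕ} (hi : i < n + 1) {m : Mon n} :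
    m ∈ monsFrom n (i + 1) d ↔ m ∈ monsFrom n i d ∧ m ⟨i, hi⟩ = 0 := by
  simp only [mem_monsFrom]
  constructor
  · rintro ⟨h1, h2⟩
    exact ⟨⟨h1, fun l hl => h2 l (by omega)⟩, h2 _ (by simp)⟩
  · rintro ⟨⟨h1, h2⟩, h3⟩
    refine ⟨h1, fun l hl => ?_⟩
    rcases Nat.lt_or_ge l.val i with h | h
    · exact h2 l h
    · have : l = ⟨i, hi⟩ := Fin.ext (by simp; omega)
      rw [this, h3]

/-- `colon l S` consists of the monomials `m` with `x_l m ∈ S`. -/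
noncomputable def colon {n : ℕ} (l : Fin (n + 1)) (S : Finset (Mon n)) : Finset (Mon n) :=
  S.preimage (fun m => m + monX l) (fun _ _ _ _ h => add_right_cancel h)

theorem mem_colon {n : ℕ} {l : Fin (n + 1)} {S : Finset (Mon n)} {m : Mon n} :
    m ∈ colon l S ↔ m + monX l ∈ S := by
  unfold colon
  exact Finset.mem_preimage

theorem card_colon {n : ℕ} (l : Fin (n + 1)) (S : Finset (Mon n)) :
    (colon l S).card = (S.filter fun m => 1 ≤ m l).card := by
  apply Finset.card_bij (fun m _ => m + monX l)
  · intro m hm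
    rw [mem_colon] at hm
    simp [hm, monX_same]
  · intro a _ b _ h
    exact add_right_cancel h
  · intro m hm
    rw [Finset.mem_filter] at hm
    obtain ⟨m', rfl⟩ := exists_eq_add_monX hm.2
    exact ⟨m', mem_colon.2 hm.1, rfl⟩

theorem card_eq_free_add_colon {n : ℕ} (l : Fin (n + 1)) (S : Finset (Mon n)) :
    S.card = (S.filter fun m => m l = 0).card + (colon l S).card := by
  rw [card_colon, ← Finset.card_filter_add_card_filter_not (s := S) (fun m => m l = 0)]
  congr 2
  ext m
  simp only [Finset.mem_filter]
  constructor <;> rintro ⟨h1, h2⟩ <;> exact ⟨h1, by omega⟩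

theorem colon_filter_free {n : ℕ} {l k : Fin (n + 1)} (h : k ≠ l) (S : Finset (Mon n)) :
    colon l (S.filter fun m => m k = 0) = (colon l S).filter fun m => m k = 0 := by
  ext m
  simp [mem_colon, monX_ne h]

theorem colon_comm {n : ℕ} (l k : Fin (n + 1)) (S : Finset (Mon n)) :
    colon l (colon k S) = colon k (colon l S) := by
  ext m
  simp only [mem_colon]
  rw [add_right_comm]

/-! ### The degree-lexicographic order -/

theorem deglexLT_iff {n : ℕ} (a b : Mon n) : deglexLT a b ↔ toColex a < toColex b := by
  constructor
  · rintro ⟨k, h1, h2⟩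
    exact ⟨k, fun j hj => h2 j hj, h1⟩
  · rintro ⟨k, h2, h1⟩
    exact ⟨k, h1, fun j hj => h2 j hj⟩

theorem deglexLT_trichotomy {n : ℕ} (a b : Mon n) : deglexLT a b ∨ a = b ∨ deglexLT b a := by
  simp only [deglexLT_iff]
  rcases lt_trichotomy (toColex a) (toColex b) with h | h | h
  · exact Or.inl h
  · exact Or.inr (Or.inl (toColex_inj.1 h))
  · exact Or.inr (Or.inr h)

theorem deglexLT_asymm {n : ℕ} {a b : Mon n} (h : deglexLT a b) : ¬ deglexLT b a := by
  rw [deglexLT_iff] at *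
  exact h.asymm

theorem deglexLT_add_right {n : ℕ} {a b : Mon n} (h : deglexLT a b) (c : Mon n) :
    deglexLT (a + c) (b + c) := by
  obtain ⟨k, h1, h2⟩ := h
  refine ⟨k, ?_, fun l hl => ?_⟩
  · simp only [Pi.add_apply]; omega
  · simp only [Pi.add_apply, h2 l hl]

theorem deglexLT_monX {n : ℕ} {a b : Fin (n + 1)} (h : a < b) (m : Mon n) :
    deglexLT (m + monX a) (m + monX b) := by
  refine ⟨b, ?_, fun l hl => ?_⟩
  · simp only [Pi.add_apply, monX_same, monX_ne (ne_of_gt h)]; omega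
  · simp only [Pi.add_apply]
    rw [monX_ne (ne_of_gt hl), monX_ne (ne_of_gt (h.trans hl))]

/-- Initial segments of the monomials of degree `d` in `x_i, …, x_n`. -/
def IsSeg {n : ℕ} (i d : ℕ) (S : Finset (Mon n)) : Prop :=
  S ⊆ monsFrom n i d ∧ ∀ a ∈ S, ∀ b ∈ monsFrom n i d, deglexLT b a → b ∈ S

/-- Sets of monomials of degree `d` in `x_i, …, x_n` closed under downward Borel moves. -/
def IsDown {n : ℕ} (i d : ℕ) (S : Finset (Mon n)) : Prop :=
  S ⊆ monsFrom n i d ∧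
    ∀ (m : Mon n) (a b : Fin (n + 1)), i ≤ a.val → a < b → m + monX b ∈ S → m + monX a ∈ S

theorem IsSeg.isDown {n i d : ℕ} {S : Finset (Mon n)} (h : IsSeg i d S) : IsDown i d S := by
  refine ⟨h.1, fun m a b ha hab hm => ?_⟩
  refine h.2 _ hm _ ?_ (deglexLT_monX hab m)
  have h1 := h.1 hm
  rw [mem_monsFrom, mdeg_add, mdeg_monX] at h1 ⊢
  refine ⟨h1.1, fun l hl => ?_⟩
  have := h1.2 l hl
  simp only [Pi.add_apply] at this ⊢
  rw [monX_ne (by rintro rfl; omega)]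
  omega

theorem IsSeg.subset_of_card_le {n i d : ℕ} {S S' : Finset (Mon n)} (h : IsSeg i d S)
    (h' : IsSeg i d S') (hc : S.card ≤ S'.card) : S ⊆ S' := by
  by_contra hn
  obtain ⟨x, hx, hx'⟩ := Finset.not_subset.1 hn
  have hsub : S' ⊆ S := by
    intro y hy
    rcases deglexLT_trichotomy x y with hlt | rfl | hlt
    · exact absurd (h'.2 y hy x (h.1 hx) hlt) hx'
    · exact hx
    · exact h.2 x hx y (h'.1 hy) hlt
  have := Finset.eq_of_subset_of_card_le hsub hc
  exact hx' (this ▸ hx)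

theorem exists_isSeg (n i d : ℕ) {a : ℕ} (ha : a ≤ (monsFrom n i d).card) :
    ∃ S : Finset (Mon n), IsSeg i d S ∧ S.card = a := by
  induction a with
  | zero => exact ⟨∅, ⟨by simp, by simp⟩, rfl⟩
  | succ a ih =>
    obtain ⟨S, hS, rfl⟩ := ih (by omega)
    have hne : (monsFrom n i d \ S).Nonempty := by
      rw [← Finset.card_pos, Finset.card_sdiff_of_subset hS.1]
      omega
    obtain ⟨x, hx, hmin⟩ := Finset.exists_min_image _ (toColex : Mon n → _) hne
    rw [Finset.mem_sdiff] at hx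
    refine ⟨insert x S, ⟨?_, ?_⟩, Finset.card_insert_of_notMem hx.2⟩
    · exact Finset.insert_subset hx.1 hS.1
    · intro y hy b hb hlt
      rw [Finset.mem_insert] at hy ⊢
      rcases hy with rfl | hy
      · by_contra hc
        push Not at hc
        exact absurd (hmin b (Finset.mem_sdiff.2 ⟨hb, hc.2⟩))
          (not_le.2 ((deglexLT_iff _ _).1 hlt))
      · exact Or.inr (hS.2 y hy b hb hlt)

theorem IsSeg.isSeg_colon {n i d : ℕ} {S : Finset (Mon n)} (h : IsSeg i (d + 1) S) {l : Fin (n + 1)}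
    (hl : i ≤ l.val) : IsSeg i d (colon l S) := by
  refine ⟨fun m hm => ?_, fun a ha b hb hlt => ?_⟩
  · exact (add_monX_mem_monsFrom hl).1 (h.1 (mem_colon.1 hm))
  · rw [mem_colon] at ha ⊢
    exact h.2 _ ha _ ((add_monX_mem_monsFrom hl).2 hb) (deglexLT_add_right hlt _)

theorem IsDown.isDown_colon {n i d : ℕ} {S : Finset (Mon n)} (h : IsDown i (d + 1) S)
    {l : Fin (n + 1)} (hl : i ≤ l.val) : IsDown i d (colon l S) := by
  refine ⟨fun m hm => ?_, fun m a b ha hab hm => ?_⟩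
  · exact (add_monX_mem_monsFrom hl).1 (h.1 (mem_colon.1 hm))
  · rw [mem_colon] at hm ⊢
    rw [add_right_comm] at hm ⊢
    exact h.2 _ a b ha hab hm

theorem IsSeg.free {n i d : ℕ} {S : Finset (Mon n)} (h : IsSeg i d S) (hi : i < n + 1) :
    IsSeg (i + 1) d (S.filter fun m => m ⟨i, hi⟩ = 0) := by
  refine ⟨fun m hm => ?_, fun a ha b hb hlt => ?_⟩
  · rw [Finset.mem_filter] at hm
    exact (mem_monsFrom_succ hi).2 ⟨h.1 hm.1, hm.2⟩
  · rw [Finset.mem_filter] at ha ⊢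
    rw [mem_monsFrom_succ hi] at hb
    exact ⟨h.2 _ ha.1 _ hb.1 hlt, hb.2⟩

theorem IsDown.free {n i d : ℕ} {S : Finset (Mon n)} (h : IsDown i d S) (hi : i < n + 1) :
    IsDown (i + 1) d (S.filter fun m => m ⟨i, hi⟩ = 0) := by
  refine ⟨fun m hm => ?_, fun m a b ha hab hm => ?_⟩
  · rw [Finset.mem_filter] at hm
    exact (mem_monsFrom_succ hi).2 ⟨h.1 hm.1, hm.2⟩
  · rw [Finset.mem_filter] at hm ⊢
    refine ⟨h.2 _ a b (by omega) hab hm.1, ?_⟩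
    have h2 := hm.2
    simp only [Pi.add_apply] at h2 ⊢
    rw [monX_ne (by rintro rfl; simp at ha)]
    omega

/-! ### Counting monomials and the size of colon sets of segments -/

/-- The monomials of degree `d` in `x_i, …, x_{j-1}`. -/
noncomputable def monsIn (n i j d : ℕ) : Finset (Mon n) :=
  (monsFrom n i d).filter fun m => ∀ l : Fin (n + 1), j ≤ l.val → m l = 0

theorem mem_monsIn {n i j d : ℕ} {m : Mon n} :
    m ∈ monsIn n i j d ↔ m ∈ monsFrom n i d ∧ ∀ l : Fin (n + 1), j ≤ l.val → m l = 0 := by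
  simp [monsIn]

theorem isSeg_monsIn (n i j d : ℕ) : IsSeg i d (monsIn n i j d) := by
  refine ⟨Finset.filter_subset _ _, fun a ha b hb hlt => ?_⟩
  rw [mem_monsIn] at ha ⊢
  refine ⟨hb, fun l hl => ?_⟩
  obtain ⟨k, h1, h2⟩ := hlt
  have hk : k.val < j := by
    by_contra hc
    have := ha.2 k (by omega)
    omega
  rw [h2 l (Fin.lt_def.2 (by omega))]
  exact ha.2 l hl

theorem monsIn_top (n i d : ℕ) : monsIn n i (n + 1) d = monsFrom n i d := by
  ext m
  rw [mem_monsIn]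
  exact ⟨fun h => h.1, fun h => ⟨h, fun l hl => absurd l.2 (by omega)⟩⟩

theorem colon_monsIn {n i j d : ℕ} {l : Fin (n + 1)} (h1 : i ≤ l.val) (h2 : l.val < j) :
    colon l (monsIn n i j (d + 1)) = monsIn n i j d := by
  ext m
  rw [mem_colon, mem_monsIn, mem_monsIn, add_monX_mem_monsFrom h1]
  refine and_congr_right fun _ => forall_congr' fun k => forall_congr' fun hk => ?_
  rw [Pi.add_apply, monX_ne (by rintro rfl; omega), add_zero]

theorem monsIn_free {n i j d : ℕ} (hj : j < n + 1) :
    (monsIn n i (j + 1) d).filter (fun m => m ⟨j, hj⟩ = 0) = monsIn n i j d := by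
  ext m
  rw [Finset.mem_filter, mem_monsIn, mem_monsIn, and_assoc]
  refine and_congr_right fun _ => ⟨fun h l hl => ?_, fun h => ⟨fun l hl => h l (by omega), h _ le_rfl⟩⟩
  rcases Nat.lt_or_ge j l.val with h' | h'
  · exact h.1 l h'
  · have : l = ⟨j, hj⟩ := Fin.ext (by simp; omega)
    rw [this, h.2]

theorem card_monsIn (n i s d : ℕ) (h : i + s ≤ n + 1) :
    (monsIn n i (i + s) d).card = s.multichoose d := by
  induction s generalizing d with
  | zero =>
    rcases d with _ | d
    · simp only [Nat.multichoose_zero_right]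
      rw [Finset.card_eq_one]
      refine ⟨0, ?_⟩
      ext m
      rw [mem_monsIn, monsFrom_zero, Finset.mem_singleton]
      constructor
      · exact fun h => h.1
      · rintro rfl; simp
    · rw [Nat.multichoose_zero_succ, Finset.card_eq_zero, Finset.eq_empty_iff_forall_notMem]
      intro m hm
      rw [mem_monsIn, mem_monsFrom] at hm
      obtain ⟨l, hl⟩ := exists_pos_of_mdeg_pos (m := m) (by omega)
      rcases Nat.lt_or_ge l.val i with h' | h'
      · have := hm.1.2 l h'; omega
      · have := hm.2 l (by omega); omega
  | succ s ih =>
    induction d with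
    | zero =>
      simp only [Nat.multichoose_zero_right]
      rw [Finset.card_eq_one]
      refine ⟨0, ?_⟩
      ext m
      rw [mem_monsIn, monsFrom_zero, Finset.mem_singleton]
      constructor
      · exact fun h => h.1
      · rintro rfl; simp
    | succ d ihd =>
      have hj : i + s < n + 1 := by omega
      rw [card_eq_free_add_colon ⟨i + s, hj⟩, ← add_assoc i s 1, monsIn_free hj,
        colon_monsIn (by simp) (by simp), ih _ (by omega), add_assoc i s 1, ihd,
        Nat.multichoose_succ_succ]

theorem multichoose_succ_eq (s d : ℕ) : (s + 1).multichoose d = (s + d).choose d := by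
  rw [Nat.multichoose_eq]
  congr 1
  omega

theorem card_monsFrom {n i : ℕ} (hi : i ≤ n) (d : ℕ) :
    (monsFrom n i d).card = (n - i + d).choose d := by
  rw [← monsIn_top, ← multichoose_succ_eq, ← card_monsIn n i (n - i + 1) d (by omega)]
  congr 2
  omega

theorem colon_eq_empty_of_degree_zero {n i : ℕ} {S : Finset (Mon n)} (h : S ⊆ monsFrom n i 0)
    (l : Fin (n + 1)) : colon l S = ∅ := by
  rw [Finset.eq_empty_iff_forall_notMem]
  intro m hm
  have := h (mem_colon.1 hm)
  rw [mem_monsFrom, mdeg_add, mdeg_monX] at this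
  omega

/-- For a segment `S`, the colon set by the least variable has the size predicted by
`minusMinus`. -/
theorem IsSeg.card_colon {n i d : ℕ} {S : Finset (Mon n)} (hS : IsSeg i d S) (hi : i < n + 1) :
    (colon ⟨i, hi⟩ S).card = minusMinus S.card d := by
  induction d generalizing S with
  | zero => rw [colon_eq_empty_of_degree_zero hS.1]; simp [minusMinus]
  | succ d ih =>
    rcases Nat.eq_zero_or_pos S.card with h0 | hpos
    · rw [h0, minusMinus_zero]
      rw [Finset.card_eq_zero] at h0
      subst h0
      rw [Finset.card_eq_zero, Finset.eq_empty_iff_forall_notMem]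
      intro m hm
      simpa using mem_colon.1 hm
    have hex : ∃ s, 1 ≤ s ∧ i + s ≤ n + 1 ∧ s.multichoose (d + 1) ≤ S.card ∧
        (i + s + 1 ≤ n + 1 → S.card < (s + 1).multichoose (d + 1)) := by
      by_contra hc
      push Not at hc
      have key : ∀ s, i + (s + 1) ≤ n + 1 → (s + 1).multichoose (d + 1) ≤ S.card := by
        intro s
        induction s with
        | zero => intro _; rw [multichoose_succ_eq]; simpa using hpos
        | succ s ihs =>
          intro hs
          exact (hc (s + 1) (by omega) (by omega) (ihs (by omega))).2
      exact absurd (hc (n - i + 1) (by omega) (by omega) (key (n - i) (by omega))).1 (by omega)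
    obtain ⟨s, hs1, hs2, hs3, hs4⟩ := hex
    obtain ⟨s, rfl⟩ : ∃ s', s = s' + 1 := ⟨s - 1, by omega⟩
    have hVS : monsIn n i (i + (s + 1)) (d + 1) ⊆ S :=
      (isSeg_monsIn _ _ _ _).subset_of_card_le hS (by rw [card_monsIn _ _ _ _ hs2]; exact hs3)
    rcases Nat.lt_or_ge (i + (s + 1)) (n + 1) with hlt | hge
    · have hSV : S ⊆ monsIn n i (i + (s + 1) + 1) (d + 1) := by
        refine hS.subset_of_card_le (isSeg_monsIn _ _ _ _) ?_
        rw [add_assoc i, card_monsIn _ _ _ _ (by omega)]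
        exact (hs4 (by omega)).le
      set l : Fin (n + 1) := ⟨i + (s + 1), hlt⟩ with hl
      have hfree : S.filter (fun m => m l = 0) = monsIn n i (i + (s + 1)) (d + 1) := by
        apply Finset.Subset.antisymm
        · rw [← monsIn_free hlt]
          exact Finset.filter_subset_filter _ hSV
        · intro m hm
          rw [Finset.mem_filter]
          exact ⟨hVS hm, (mem_monsIn.1 hm).2 _ le_rfl⟩
      have hcard := card_eq_free_add_colon l S
      rw [hfree, card_monsIn _ _ _ _ hs2, multichoose_succ_eq] at hcard
      have hlt' := hs4 (by omega)
      rw [Nat.multichoose_succ_succ, multichoose_succ_eq, multichoose_succ_eq] at hlt'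
      have hc2 := card_eq_free_add_colon l (colon ⟨i, hi⟩ S)
      have hne : l ≠ ⟨i, hi⟩ := by
        intro h
        have := congrArg Fin.val h
        simp [hl] at this
      rw [← colon_filter_free hne, hfree, colon_monsIn (by simp) (by simp),
        card_monsIn _ _ _ _ hs2, multichoose_succ_eq, colon_comm,
        ih (hS.isSeg_colon (by simp [hl]))] at hc2
      rw [hc2, hcard, show s + (d + 1) = s + d + 1 by omega,
        minusMinus_choose_add (by omega) (by
          rw [show s + 1 + d = s + d + 1 by omega] at hlt'
          rw [show s + (d + 1) = s + d + 1 by omega] at hcard hlt'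
          omega)]
    · have hn : i + (s + 1) = n + 1 := by omega
      rw [hn, monsIn_top] at hVS
      have hSe : S = monsIn n i (i + (s + 1)) (d + 1) := by
        rw [hn, monsIn_top]
        exact Finset.Subset.antisymm hS.1 hVS
      rw [hSe, colon_monsIn (by simp) (by simp), card_monsIn _ _ _ _ hs2, card_monsIn _ _ _ _ hs2,
        multichoose_succ_eq, multichoose_succ_eq]
      exact (minusMinus_choose (by omega)).symm

/-! ### Colon sets of Borel sets are at least as large as those of segments -/

theorem mdeg_nsmul_monX {n : ℕ} (c : ℕ) (l : Fin (n + 1)) : mdeg (c • monX l) = c := by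
  simp only [mdeg, Pi.smul_apply, smul_eq_mul, ← Finset.mul_sum]
  have : mdeg (monX l) = 1 := mdeg_monX l
  rw [mdeg] at this
  rw [this, mul_one]

/-- Replace the variable `x_a` by `x_b` in a monomial. -/
def mergeVar {n : ℕ} (a b : Fin (n + 1)) (m : Mon n) : Mon n :=
  fun l => if l = a then 0 else if l = b then m a + m b else m l

theorem mergeVar_add_monX {n : ℕ} {a b : Fin (n + 1)} (hab : a ≠ b) (m : Mon n) :
    mergeVar a b (m + monX a) = mergeVar a b m + monX b := by
  funext l
  simp only [mergeVar, Pi.add_apply, monX_same, monX_ne hab.symm]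
  split_ifs with h1 h2
  · subst h1; rw [monX_ne hab]
  · subst h2; rw [monX_same]; omega
  · rw [monX_ne h1, monX_ne h2]

theorem mergeVar_eq_self {n : ℕ} {a b : Fin (n + 1)} {m : Mon n} (h : m a = 0) :
    mergeVar a b m = m := by
  funext l
  simp only [mergeVar]
  split_ifs with h1 h2
  · rw [h1, h]
  · rw [h2, h, zero_add]
  · rfl

theorem mdeg_mergeVar {n : ℕ} {a b : Fin (n + 1)} (hab : a ≠ b) (m : Mon n) :
    mdeg (mergeVar a b m) = mdeg m := by
  have h : mergeVar a b m + m a • monX a = m + m a • monX b := by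
    funext l
    simp only [mergeVar, Pi.add_apply, Pi.smul_apply, smul_eq_mul, monX_apply]
    split_ifs with h1 h2 h2 <;> simp_all
    omega
  have := congrArg mdeg h
  rw [mdeg_add, mdeg_add, mdeg_nsmul_monX, mdeg_nsmul_monX] at this
  omega

theorem mergeVar_mem_monsFrom {n i d : ℕ} {a b : Fin (n + 1)} (ha : a.val = i)
    (hb : b.val = i + 1) {m : Mon n} (hm : m ∈ monsFrom n i d) :
    mergeVar a b m ∈ monsFrom n (i + 1) d := by
  have hab : a ≠ b := by rintro rfl; omega
  rw [mem_monsFrom] at hm ⊢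
  rw [mdeg_mergeVar hab]
  refine ⟨hm.1, fun l hl => ?_⟩
  simp only [mergeVar]
  split_ifs with h1 h2
  · rfl
  · subst h2; omega
  · exact hm.2 l (by
      have : l.val ≠ a.val := fun h => h1 (Fin.ext h)
      omega)

/-- The monomials that land in `E` after replacing `x_a` by `x_b`. -/
noncomputable def mergePre {n : ℕ} (i d : ℕ) (a b : Fin (n + 1)) (E : Finset (Mon n)) :
    Finset (Mon n) :=
  (monsFrom n i d).filter fun m => mergeVar a b m ∈ E

theorem mem_mergePre {n i d : ℕ} {a b : Fin (n + 1)} {E : Finset (Mon n)} {m : Mon n} :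
    m ∈ mergePre i d a b E ↔ m ∈ monsFrom n i d ∧ mergeVar a b m ∈ E := by
  simp [mergePre]

theorem mergePre_free {n i d : ℕ} {a b : Fin (n + 1)} (ha : a.val = i) {E : Finset (Mon n)}
    (hE : E ⊆ monsFrom n (i + 1) d) : (mergePre i d a b E).filter (fun m => m a = 0) = E := by
  ext m
  rw [Finset.mem_filter, mem_mergePre]
  constructor
  · rintro ⟨⟨_, h1⟩, h2⟩
    rwa [mergeVar_eq_self h2] at h1
  · intro hm
    have h1 := hE hm
    have h2 := (mem_monsFrom.1 h1).2 a (by omega)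
    exact ⟨⟨monsFrom_mono (Nat.le_succ i) h1, by rwa [mergeVar_eq_self h2]⟩, h2⟩

theorem colon_mergePre {n i d : ℕ} {a b : Fin (n + 1)} (ha : a.val = i) (hab : a ≠ b)
    (E : Finset (Mon n)) :
    colon a (mergePre i (d + 1) a b E) = mergePre i d a b (colon b E) := by
  ext m
  rw [mem_colon, mem_mergePre, mem_mergePre, mem_colon, mergeVar_add_monX hab,
    add_monX_mem_monsFrom (by omega)]

theorem IsDown.colon_free_subset {n i d : ℕ} {a b : Fin (n + 1)} (ha : a.val = i)
    (hb : b.val = i + 1) {C : Finset (Mon n)} (hC : IsDown i d C) :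
    colon b (C.filter fun m => m a = 0) ⊆ (colon a C).filter fun m => m a = 0 := by
  intro m hm
  rw [mem_colon, Finset.mem_filter] at hm
  rw [Finset.mem_filter, mem_colon]
  refine ⟨hC.2 m a b (by omega) (Fin.lt_def.2 (by omega)) hm.1, ?_⟩
  have := hm.2
  simp only [Pi.add_apply] at this
  omega

theorem card_mergePre_le {n i : ℕ} {a b : Fin (n + 1)} (ha : a.val = i) (hb : b.val = i + 1)
    (IH : ∀ (d : ℕ) (C : Finset (Mon n)), IsDown (i + 1) d C →
      minusMinus C.card d ≤ (colon b C).card)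
    (d : ℕ) : ∀ C E : Finset (Mon n), IsDown i d C → IsSeg (i + 1) d E →
      E.card ≤ (C.filter fun m => m a = 0).card → (mergePre i d a b E).card ≤ C.card := by
  have hab : a ≠ b := by rintro rfl; omega
  have hb' : (⟨i + 1, by omega⟩ : Fin (n + 1)) = b := Fin.ext hb.symm
  have ha' : (⟨i, by omega⟩ : Fin (n + 1)) = a := Fin.ext ha.symm
  induction d with
  | zero =>
    intro C E hC hE hle
    rw [card_eq_free_add_colon a (mergePre i 0 a b E), mergePre_free ha hE.1,
      colon_eq_empty_of_degree_zero (i := i) (S := mergePre i 0 a b E) (Finset.filter_subset _ _),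
      Finset.card_empty, add_zero]
    exact hle.trans (Finset.card_filter_le _ _)
  | succ d ih =>
    intro C E hC hE hle
    rw [card_eq_free_add_colon a (mergePre i _ a b E), mergePre_free ha hE.1,
      card_eq_free_add_colon a C, colon_mergePre ha hab]
    refine Nat.add_le_add hle (ih _ _ (hC.isDown_colon (by omega)) (hE.isSeg_colon (by omega)) ?_)
    have h1 := hE.card_colon (by omega)
    rw [hb'] at h1
    rw [h1]
    have hfree := hC.free (by omega)
    rw [ha'] at hfree
    exact (minusMinus_mono _ hle).trans ((IH _ _ hfree).trans
      (Finset.card_le_card (hC.colon_free_subset ha hb)))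

theorem mem_mergePre_of_lt {n i d : ℕ} {a b : Fin (n + 1)} (ha : a.val = i)
    (hb : b.val = i + 1) {E : Finset (Mon n)} (hE : IsSeg (i + 1) d E) {m x : Mon n}
    (hm : m ∈ monsFrom n i d) (hx : x ∈ E) (hlt : deglexLT m x) : m ∈ mergePre i d a b E := by
  have hab : a ≠ b := by rintro rfl; omega
  rw [mem_mergePre]
  refine ⟨hm, ?_⟩
  by_contra hn
  have hσ := mergeVar_mem_monsFrom ha hb hm
  have hxm := mem_monsFrom.1 (hE.1 hx)
  rcases deglexLT_trichotomy (mergeVar a b m) x with h | h | h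
  · exact hn (hE.2 x hx _ hσ h)
  · exact hn (h ▸ hx)
  · have hval : ∀ k : Fin (n + 1), i + 1 < k.val → mergeVar a b m k = m k := by
      intro k hk
      simp only [mergeVar]
      rw [if_neg (by rintro rfl; omega), if_neg (by rintro rfl; omega)]
    obtain ⟨k, h1, h2⟩ := hlt
    have hki : i + 1 ≤ k.val := by
      by_contra hc
      have := hxm.2 k (by omega)
      omega
    rcases Nat.lt_or_ge (i + 1) k.val with hk | hk
    · refine deglexLT_asymm h ⟨k, by rw [hval k hk]; exact h1, fun l hl => ?_⟩
      have := Fin.lt_def.1 hl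
      rw [hval l (by omega)]
      exact h2 l hl
    · obtain ⟨k', h1', h2'⟩ := h
      have hσ' := mem_monsFrom.1 hσ
      have hki' : i + 1 ≤ k'.val := by
        by_contra hc
        have := hσ'.2 k' (by omega)
        omega
      rcases Nat.lt_or_ge (i + 1) k'.val with hk' | hk'
      · have := h2 k' (Fin.lt_def.2 (by omega))
        rw [hval k' hk'] at h1'
        omega
      · have : mdeg x < mdeg (mergeVar a b m) := by
          refine Finset.sum_lt_sum (fun l _ => ?_) ⟨k', Finset.mem_univ _, h1'⟩
          rcases lt_trichotomy l k' with hl | rfl | hl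
          · rw [hxm.2 l (by have := Fin.lt_def.1 hl; omega)]; exact Nat.zero_le _
          · exact h1'.le
          · exact (h2' l hl).le
        omega

theorem isSeg_of_subset_monsFrom_last {n d : ℕ} {C : Finset (Mon n)} (h : C ⊆ monsFrom n n d) :
    IsSeg n d C := by
  refine ⟨h, fun a ha b hb _ => ?_⟩
  have hc : (monsFrom n n d).card = 1 := by rw [card_monsFrom le_rfl]; simp
  rw [Finset.card_eq_one] at hc
  obtain ⟨x, hx⟩ := hc
  have h1 := h ha
  rw [hx, Finset.mem_singleton] at h1 hb
  rwa [hb, ← h1]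

/-- The combinatorial form of Green's hyperplane restriction theorem. -/
theorem IsDown.minusMinus_le_card_colon {n i : ℕ} (hi : i < n + 1) :
    ∀ {d : ℕ} {C : Finset (Mon n)}, IsDown i d C →
      minusMinus C.card d ≤ (colon ⟨i, hi⟩ C).card := by
  induction h : n - i generalizing i with
  | zero =>
    intro d C hC
    obtain rfl : i = n := by omega
    rw [(isSeg_of_subset_monsFrom_last hC.1).card_colon hi]
  | succ s ih =>
    intro d C hC
    have hi1 : i + 1 < n + 1 := by omega
    have IH := fun (d : ℕ) (C : Finset (Mon n)) => ih hi1 (by omega) (d := d) (C := C)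
    by_contra hlt
    rw [not_le] at hlt
    obtain ⟨D, hD, hDc⟩ := exists_isSeg n i d (Finset.card_le_card hC.1)
    have hcol := hD.card_colon hi
    rw [hDc] at hcol
    have e1 := card_eq_free_add_colon ⟨i, hi⟩ C
    have e2 := card_eq_free_add_colon ⟨i, hi⟩ D
    have hCf := Finset.card_le_card (hC.free hi).1
    obtain ⟨E, hE, hEc⟩ := exists_isSeg n (i + 1) d
      (a := (D.filter fun m => m ⟨i, hi⟩ = 0).card + 1) (by omega)
    have hK := card_mergePre_le (i := i) (a := ⟨i, hi⟩) (b := ⟨i + 1, hi1⟩) rfl rfl IH d C E hC hE (by omega)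
    obtain ⟨x, hxE, hxD⟩ := Finset.exists_mem_notMem_of_card_lt_card
      (show (D.filter fun m => m ⟨i, hi⟩ = 0).card < E.card by omega)
    have hx0 : x ⟨i, hi⟩ = 0 := (mem_monsFrom.1 (hE.1 hxE)).2 _ (by simp)
    have hxD' : x ∉ D := fun h => hxD (Finset.mem_filter.2 ⟨h, hx0⟩)
    have hxi : x ∈ monsFrom n i d := monsFrom_mono (Nat.le_succ i) (hE.1 hxE)
    have hxp : x ∈ mergePre i d (⟨i, hi⟩ : Fin (n + 1)) ⟨i + 1, hi1⟩ E := by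
      rw [mem_mergePre, mergeVar_eq_self hx0]
      exact ⟨hxi, hxE⟩
    have hsub : D ⊆ mergePre i d (⟨i, hi⟩ : Fin (n + 1)) ⟨i + 1, hi1⟩ E := by
      intro m hm
      refine mem_mergePre_of_lt rfl rfl hE (hD.1 hm) hxE ?_
      rcases deglexLT_trichotomy m x with h | h | h
      · exact h
      · exact absurd (h ▸ hm) hxD'
      · exact absurd (hD.2 m hm x hxi h) hxD'
    have hss := Finset.card_lt_card (Finset.ssubset_iff_subset_ne.2 ⟨hsub, fun h => hxD' (h ▸ hxp)⟩)
    omega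

/-! ### Numerical consequences -/

theorem minusMinus_sub_le (b t : ℕ) :
    minusMinus (b - minusMinus b (t + 1)) (t + 1) ≤
      minusMinus b (t + 1) - minusMinus (minusMinus b (t + 1)) t := by
  have hb : b ≤ (monsFrom (b + 1) 0 (t + 1)).card := by
    rw [card_monsFrom (Nat.zero_le _)]
    have := le_choose_add (k := b + 1 - 0 + (t + 1)) (t := t + 1) (by omega) (by omega)
    omega
  obtain ⟨n, hn, hb⟩ : ∃ n, 1 ≤ n ∧ b ≤ (monsFrom n 0 (t + 1)).card := ⟨_, by omega, hb⟩
  obtain ⟨S, hS, rfl⟩ := exists_isSeg _ _ _ hb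
  have h0 : 0 < n + 1 := by omega
  have h1 : 0 + 1 < n + 1 := by omega
  have e1 := card_eq_free_add_colon (⟨0, h0⟩ : Fin (n + 1)) S
  have e2 := hS.card_colon h0
  have hS' : IsSeg 0 t (colon ⟨0, h0⟩ S) := hS.isSeg_colon (Nat.zero_le _)
  have e3 := card_eq_free_add_colon ⟨0, h0⟩ (colon ⟨0, h0⟩ S)
  have e4 := hS'.card_colon h0
  have e5 := (hS.free h0).card_colon h1
  have e6 := Finset.card_le_card (hS.isDown.colon_free_subset (a := ⟨0, h0⟩)
    (b := ⟨0 + 1, h1⟩) rfl rfl)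
  rw [e2] at e4
  rw [e5] at e6
  have e7 : S.card - minusMinus S.card (t + 1) = (S.filter fun m => m ⟨0, h0⟩ = 0).card := by
    omega
  rw [e7]
  omega

theorem IsSeg.subset_of_succ {n i d : ℕ} {A B : Finset (Mon n)} (hi : i < n + 1)
    (hA : IsSeg i d A) (hB : IsSeg (i + 1) d B) (h : B.card + minusMinus A.card d ≤ A.card) :
    B ⊆ A := by
  refine (hB.subset_of_card_le (hA.free hi) ?_).trans (Finset.filter_subset _ _)
  have e1 := card_eq_free_add_colon ⟨i, hi⟩ A
  have e2 := hA.card_colon hi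
  omega

theorem IsSeg.mem_of_add_monX_mem {n i t : ℕ} {A S : Finset (Mon n)} (hi : i < n + 1)
    (hA : IsSeg i t A) (hS : IsSeg i (t + 1) S) (ht : 1 ≤ t) (h : S.card ≤ plusPlus A.card t)
    {m : Mon n} {l : Fin (n + 1)} (hl : i ≤ l.val) (hm : m + monX l ∈ S) : m ∈ A := by
  have hm' : m + monX ⟨i, hi⟩ ∈ S := by
    rcases Nat.lt_or_ge i l.val with h' | h'
    · exact hS.isDown.2 m ⟨i, hi⟩ l le_rfl (Fin.lt_def.2 h') hm
    · have : l = ⟨i, hi⟩ := Fin.ext (by simp; omega)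
      rwa [← this]
  have e := hS.card_colon hi
  rw [le_plusPlus_iff ht, ← e] at h
  exact (hS.isSeg_colon (l := ⟨i, hi⟩) le_rfl).subset_of_card_le hA h (mem_colon.2 hm')

theorem OSeq.toNat_le_card {w : ℕ → ℤ} (hw : OSeq w) {n : ℕ} (hn : 1 ≤ n) (h1 : w 1 ≤ n) (t : ℕ) :
    (w t).toNat ≤ (monsFrom n 1 t).card := by
  rw [card_monsFrom hn]
  induction t with
  | zero => rw [hw.2.1]; simp
  | succ t ih =>
    rcases t with _ | t
    · simp; omega
    · have h2 := hw.2.2 (t + 1) (by omega)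
      have h3 := plusPlus_mono (t := t + 1) (by omega) ih
      have h4 := plusPlus_choose (k := n - 1 + t) (t := t) (by omega)
      have h5 : (n - 1 + (t + 1)).choose (t + 1) = (n - 1 + t + 1).choose (t + 1) := rfl
      have h6 : (n - 1 + (t + 1 + 1)).choose (t + 1 + 1) = (n - 1 + t + 2).choose (t + 2) := rfl
      rw [h5, h4] at h3
      rw [h6]
      omega

/-! ### Strongly stable ideals -/

theorem MonIdeal.mem_of_le {n : ℕ} {J : Set (Mon n)} (hJ : MonIdeal J) {m m' : Mon n}
    (hm : m ∈ J) (h : m ≤ m') : m' ∈ J := by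
  have := hJ m hm (m' - m)
  rwa [add_tsub_cancel_of_le h] at this

theorem borelStep_add_monX {n : ℕ} {a b : Fin (n + 1)} (hab : a ≠ b) (m : Mon n) :
    borelStep (m + monX a) a b = m + monX b := by
  funext l
  simp only [borelStep, Pi.add_apply, monX_apply]
  split_ifs <;> simp_all

theorem stronglyStable_iff {n : ℕ} {J : Set (Mon n)} :
    StronglyStable J ↔ MonIdeal J ∧
      ∀ (m : Mon n) (a b : Fin (n + 1)), a < b → m + monX a ∈ J → m + monX b ∈ J := by
  refine and_congr_right fun _ => ⟨fun h m a b hab hm => ?_, fun h m hm a b hab ha => ?_⟩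
  · have := h _ hm a b hab (by simp [monX_same])
    rwa [borelStep_add_monX hab.ne] at this
  · obtain ⟨m', rfl⟩ := exists_eq_add_monX ha
    rw [borelStep_add_monX hab.ne]
    exact h m' a b hab hm

theorem shrinkAt_add_monX {n : ℕ} (m : Mon n) (l : Fin (n + 1)) :
    shrinkAt (m + monX l) l = m := by
  funext k
  simp only [shrinkAt, Pi.add_apply, monX_apply]
  split_ifs <;> simp

theorem isMinGen_iff {n : ℕ} {J : Set (Mon n)} {m : Mon n} :
    IsMinGen J m ↔ m ∈ J ∧ ∀ (l : Fin (n + 1)) (m' : Mon n), m = m' + monX l → m' ∉ J := by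
  refine and_congr_right fun _ => ⟨fun h l m' hm => ?_, fun h l hl => ?_⟩
  · subst hm
    have := h l (by simp [monX_same])
    rwa [shrinkAt_add_monX] at this
  · obtain ⟨m', rfl⟩ := exists_eq_add_monX hl
    rw [shrinkAt_add_monX]
    exact h l m' rfl

/-- Every monomial of `J` of degree larger than `M` is a multiple of one of smaller degree. -/
def GenLE {n : ℕ} (J : Set (Mon n)) (M : ℕ) : Prop :=
  ∀ m ∈ J, M < mdeg m → ∃ (l : Fin (n + 1)) (m' : Mon n), m = m' + monX l ∧ m' ∈ J

theorem GenLE.mono {n : ℕ} {J : Set (Mon n)} {M M' : ℕ} (h : GenLE J M) (hM : M ≤ M') :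
    GenLE J M' := fun m hm hlt => h m hm (by omega)

theorem GenLE.monReg_le {n : ℕ} {J : Set (Mon n)} {M : ℕ} (h : GenLE J M) : monReg J ≤ M := by
  refine csSup_le' ?_
  rintro d ⟨m, hm, rfl⟩
  rw [isMinGen_iff] at hm
  by_contra hc
  obtain ⟨l, m', h1, h2⟩ := h m hm.1 (by omega)
  exact hm.2 l m' h1 h2

theorem MonIdeal.finite_minGen {n : ℕ} {J : Set (Mon n)} (hJ : MonIdeal J) :
    {m | IsMinGen J m}.Finite := by
  have hanti : IsAntichain (· ≤ ·) {m | IsMinGen J m} := by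
    intro m hm m' hm' hne hle
    rw [Set.mem_ofPred_eq, isMinGen_iff] at hm hm'
    obtain ⟨l, hl⟩ : ∃ l, m l < m' l := by
      by_contra hc
      push Not at hc
      exact hne (le_antisymm hle hc)
    obtain ⟨c, hc⟩ := exists_eq_add_monX (m := m') (l := l) (by omega)
    refine hm'.2 l c hc (hJ.mem_of_le hm.1 fun k => ?_)
    have h1 := hle k
    subst hc
    simp only [Pi.add_apply, monX_apply] at h1 hl
    split_ifs at h1 with hk
    · subst hk; simp at hl; omega
    · omega
  exact hanti.finite_of_partiallyWellOrderedOn (Set.isPWO_of_wellQuasiOrderedLE _)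

theorem MonIdeal.genLE_monReg {n : ℕ} {J : Set (Mon n)} (hJ : MonIdeal J) :
    GenLE J (monReg J) := by
  intro m hm hlt
  by_contra hc
  push Not at hc
  have hmin : IsMinGen J m := isMinGen_iff.2 ⟨hm, hc⟩
  have hbdd : BddAbove {d | ∃ m : Mon n, IsMinGen J m ∧ mdeg m = d} :=
    (hJ.finite_minGen.image mdeg).bddAbove
  exact absurd (le_csSup hbdd ⟨m, hmin, rfl⟩) (not_le.2 hlt)

theorem monSat_subset_iff {n : ℕ} {J : Set (Mon n)} (hJ : StronglyStable J) :
    monSat J = J ↔ ∀ m, m + monX 0 ∈ J → m ∈ J := by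
  rw [stronglyStable_iff] at hJ
  have hset : ∀ (m : Mon n) (i : Fin (n + 1)) (k : ℕ),
      (fun l => if l = i then m l + k else m l) = m + k • monX i := by
    intro m i k
    funext l
    simp only [Pi.add_apply, Pi.smul_apply, smul_eq_mul, monX_apply]
    split_ifs <;> simp
  constructor
  · intro h m hm
    rw [← h]
    intro i
    refine ⟨1, ?_⟩
    rw [hset, one_smul]
    rcases Nat.eq_zero_or_pos i.val with hi | hi
    · rwa [show i = 0 from Fin.ext hi]
    · exact hJ.2 m 0 i (Fin.lt_def.2 hi) hm
  · intro h
    apply Set.Subset.antisymm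
    · intro m hm
      obtain ⟨k, hk⟩ := hm 0
      rw [hset] at hk
      induction k with
      | zero => simpa using hk
      | succ k ih =>
        rw [succ_nsmul, ← add_assoc] at hk
        exact ih (h _ hk)
    · intro m hm i
      exact ⟨0, by rw [hset]; simpa using hm⟩

/-- The monomials of degree `t` in `x_i, …, x_n` outside `J`. -/
noncomputable def coMons {n : ℕ} (J : Set (Mon n)) (i t : ℕ) : Finset (Mon n) :=
  (monsFrom n i t).filter fun m => m ∉ J

theorem mem_coMons {n : ℕ} {J : Set (Mon n)} {i t : ℕ} {m : Mon n} :
    m ∈ coMons J i t ↔ m ∈ monsFrom n i t ∧ m ∉ J := by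
  simp [coMons]

theorem hilb_eq {n : ℕ} (J : Set (Mon n)) (t : ℕ) : hilb J t = (coMons J 0 t).card := by
  rw [hilb, ← Set.ncard_coe_finset]
  congr 1
  ext m
  simp [mem_coMons, mem_monsFrom]

theorem coMons_anti {n : ℕ} (J : Set (Mon n)) {i j : ℕ} (h : i ≤ j) (t : ℕ) :
    coMons J j t ⊆ coMons J i t :=
  Finset.filter_subset_filter _ (monsFrom_mono h)

theorem coMons_eq_empty {n : ℕ} (J : Set (Mon n)) {i t : ℕ} (hi : n < i) (ht : 1 ≤ t) :
    coMons J i t = ∅ := by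
  rw [coMons, monsFrom_eq_empty hi ht, Finset.filter_empty]

theorem coMons_free {n : ℕ} (J : Set (Mon n)) {i : ℕ} (hi : i < n + 1) (t : ℕ) :
    (coMons J i t).filter (fun m => m ⟨i, hi⟩ = 0) = coMons J (i + 1) t := by
  ext m
  rw [Finset.mem_filter, mem_coMons, mem_coMons, mem_monsFrom_succ hi]
  tauto

theorem StronglyStable.isDown_coMons {n : ℕ} {J : Set (Mon n)} (hJ : StronglyStable J)
    (i t : ℕ) : IsDown i t (coMons J i t) := by
  rw [stronglyStable_iff] at hJ
  refine ⟨Finset.filter_subset _ _, fun m a b ha hab hm => ?_⟩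
  rw [mem_coMons] at hm ⊢
  refine ⟨?_, fun h => hm.2 (hJ.2 m a b hab h)⟩
  have hm1 := hm.1
  have hd := (mem_monsFrom.1 hm1).1
  rw [mdeg_add, mdeg_monX] at hd
  subst hd
  rw [add_monX_mem_monsFrom (by have := Fin.lt_def.1 hab; omega)] at hm1
  exact (add_monX_mem_monsFrom ha).2 hm1

theorem MonIdeal.colon_coMons_subset {n : ℕ} {J : Set (Mon n)} (hJ : MonIdeal J) {i t : ℕ}
    (hi : i < n + 1) : colon ⟨i, hi⟩ (coMons J i (t + 1)) ⊆ coMons J i t := by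
  intro m hm
  rw [mem_colon, mem_coMons, add_monX_mem_monsFrom (i := i) (l := ⟨i, hi⟩) le_rfl] at hm
  exact mem_coMons.2 ⟨hm.1, fun h => hm.2 (hJ m h _)⟩

theorem StronglyStable.mem_of_add_min {n : ℕ} {J : Set (Mon n)} (hJ : StronglyStable J) {M : ℕ}
    (hM : GenLE J M) {m : Mon n} {k : Fin (n + 1)} (hk : ∀ l, l < k → m l = 0)
    (h : m + monX k ∈ J) (hd : M ≤ mdeg m) : m ∈ J := by
  rw [stronglyStable_iff] at hJ
  obtain ⟨l, m', h1, h2⟩ := hM _ h (by rw [mdeg_add, mdeg_monX]; omega)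
  by_cases hlk : l = k
  · subst hlk
    rwa [add_right_cancel h1]
  · obtain ⟨c, rfl, rfl⟩ := exists_common_of_add_monX_eq hlk h1
    refine hJ.2 c k l ?_ h2
    by_contra hc
    have := hk l (lt_of_le_of_ne (not_lt.1 hc) hlk)
    simp [monX_same] at this

theorem StronglyStable.colon_coMons {n : ℕ} {J : Set (Mon n)} (hJ : StronglyStable J) {M : ℕ}
    (hM : GenLE J M) {i t : ℕ} (hi : i < n + 1) (ht : M ≤ t) :
    colon ⟨i, hi⟩ (coMons J i (t + 1)) = coMons J i t := by
  refine Finset.Subset.antisymm (hJ.1.colon_coMons_subset hi) fun m hm => ?_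
  rw [mem_coMons] at hm
  rw [mem_colon, mem_coMons, add_monX_mem_monsFrom (i := i) (l := ⟨i, hi⟩) le_rfl]
  have h1 := mem_monsFrom.1 hm.1
  exact ⟨hm.1, fun h => hm.2 (hJ.mem_of_add_min hM (fun l hl => h1.2 l hl) h (by omega))⟩

theorem StronglyStable.card_coMons_succ {n : ℕ} {J : Set (Mon n)} (hJ : StronglyStable J) {M : ℕ}
    (hM : GenLE J M) (i : ℕ) {t : ℕ} (h1 : 1 ≤ t) (ht : M ≤ t) :
    (coMons J i (t + 1)).card = (coMons J (i + 1) (t + 1)).card + (coMons J i t).card := by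
  rcases Nat.lt_or_ge i (n + 1) with hi | hi
  · rw [card_eq_free_add_colon ⟨i, hi⟩ (coMons J i (t + 1)), coMons_free, hJ.colon_coMons hM hi ht]
  · rw [coMons_eq_empty J (by omega) (by omega), coMons_eq_empty J (by omega) (by omega),
      coMons_eq_empty J (by omega) h1]
    rfl

theorem colon_coMons_zero {n : ℕ} {J : Set (Mon n)} (hJ : MonIdeal J)
    (hs : ∀ m, m + monX 0 ∈ J → m ∈ J) (t : ℕ) :
    colon 0 (coMons J 0 (t + 1)) = coMons J 0 t := by
  refine Finset.Subset.antisymm 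
    (hJ.colon_coMons_subset (Nat.succ_pos n)) fun m hm => ?_
  rw [mem_coMons] at hm
  rw [mem_colon, mem_coMons, add_monX_mem_monsFrom (Nat.zero_le _)]
  exact ⟨hm.1, fun h => hm.2 (hs m h)⟩

theorem hilb_succ {n : ℕ} {J : Set (Mon n)} (hJ : MonIdeal J)
    (hs : ∀ m, m + monX 0 ∈ J → m ∈ J) (t : ℕ) :
    hilb J (t + 1) = (coMons J 1 (t + 1)).card + hilb J t := by
  rw [hilb_eq, hilb_eq, card_eq_free_add_colon 0, colon_coMons_zero hJ hs]
  congr 2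
  exact coMons_free J (i := 0) (by omega) (t + 1)

/-- The number of monomials of degree `d + 1` outside `J` with least variable `x_i`. -/
noncomputable def growth {n : ℕ} (J : Set (Mon n)) (d i : ℕ) : ℕ :=
  (coMons J i (d + 1)).card - (coMons J (i + 1) (d + 1)).card

theorem growth_eq {n : ℕ} (J : Set (Mon n)) (d : ℕ) {i : ℕ} (hi : i < n + 1) :
    growth J d i = (colon ⟨i, hi⟩ (coMons J i (d + 1))).card := by
  have := card_eq_free_add_colon ⟨i, hi⟩ (coMons J i (d + 1))
  rw [coMons_free] at this
  rw [growth]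
  omega

theorem growth_eq_zero {n : ℕ} (J : Set (Mon n)) (d : ℕ) {i : ℕ} (hi : n < i) :
    growth J d i = 0 := by
  rw [growth, coMons_eq_empty J hi (by omega)]
  simp

theorem StronglyStable.growth_succ {n : ℕ} {J : Set (Mon n)} (hJ : StronglyStable J) (d i : ℕ) :
    growth J d (i + 1) + minusMinus (growth J d i) d ≤ growth J d i := by
  rcases Nat.lt_or_ge i (n + 1) with hi | hi
  · have hD := hJ.isDown_coMons i (d + 1)
    have hC := hD.isDown_colon (l := ⟨i, hi⟩) le_rfl
    have e1 := card_eq_free_add_colon ⟨i, hi⟩ (colon ⟨i, hi⟩ (coMons J i (d + 1)))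
    have e2 := hC.minusMinus_le_card_colon hi
    rw [← growth_eq J d hi] at e1 e2
    rcases Nat.lt_or_ge (i + 1) (n + 1) with hi' | hi'
    · have e3 := Finset.card_le_card (hD.colon_free_subset (a := ⟨i, hi⟩) (b := ⟨i + 1, hi'⟩) rfl rfl)
      rw [coMons_free, ← growth_eq J d hi'] at e3
      omega
    · rw [growth_eq_zero J d (by omega : n < i + 1)]
      omega
  · rw [growth_eq_zero J d (by omega), growth_eq_zero J d (by omega), minusMinus_zero]

theorem growth_zero {n : ℕ} {J : Set (Mon n)} (hJ : MonIdeal J)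
    (hs : ∀ m, m + monX 0 ∈ J → m ∈ J) (d : ℕ) : growth J d 0 = hilb J d := by
  rw [growth_eq J d (by omega : 0 < n + 1), hilb_eq]
  exact congrArg _ (colon_coMons_zero hJ hs d)

theorem hilb_add_growth_le {n : ℕ} {J : Set (Mon n)} (hJ : MonIdeal J)
    (hs : ∀ m, m + monX 0 ∈ J → m ∈ J) (d : ℕ) :
    hilb J d + growth J (d + 1) 1 ≤ growth J (d + 1) 0 := by
  rw [growth_zero hJ hs, hilb_succ hJ hs, add_comm]
  refine Nat.add_le_add_right ?_ _
  rcases Nat.lt_or_ge 1 (n + 1) with hi | hi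
  · rw [growth_eq _ _ hi]
    exact Finset.card_le_card (hJ.colon_coMons_subset hi)
  · rw [growth_eq_zero _ _ (by omega)]
    exact Nat.zero_le _

theorem StronglyStable.card_coMons_le_plusPlus {n : ℕ} {J : Set (Mon n)} (hJ : StronglyStable J)
    (i : ℕ) {t : ℕ} (ht : 1 ≤ t) :
    (coMons J i (t + 1)).card ≤ plusPlus (coMons J i t).card t := by
  rcases Nat.lt_or_ge i (n + 1) with hi | hi
  · rw [le_plusPlus_iff ht]
    exact ((hJ.isDown_coMons i (t + 1)).minusMinus_le_card_colon hi).trans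
      (Finset.card_le_card (hJ.1.colon_coMons_subset hi))
  · rw [coMons_eq_empty J (by omega) (by omega)]
    exact Nat.zero_le _

theorem card_coMons_degree_zero {n : ℕ} {J : Set (Mon n)} (h0 : (0 : Mon n) ∉ J) (i : ℕ) :
    (coMons J i 0).card = 1 := by
  rw [coMons, monsFrom_zero, Finset.filter_singleton, if_pos h0, Finset.card_singleton]

theorem StronglyStable.oSeq_hilb {n : ℕ} {J : Set (Mon n)} (hJ : StronglyStable J)
    (h0 : (0 : Mon n) ∉ J) : OSeq (fun t => (hilb J t : ℤ)) := by
  refine ⟨fun t => Int.natCast_nonneg _, ?_, fun t ht => ?_⟩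
  · simp [hilb_eq, card_coMons_degree_zero h0]
  · simp only [hilb_eq, Int.toNat_natCast]
    exact_mod_cast hJ.card_coMons_le_plusPlus 0 ht

theorem StronglyStable.oSeq_nderiv_hilb {n : ℕ} {J : Set (Mon n)} (hJ : StronglyStable J)
    (hs : ∀ m, m + monX 0 ∈ J → m ∈ J) (h0 : (0 : Mon n) ∉ J) :
    OSeq (nderiv fun t => (hilb J t : ℤ)) := by
  have h : (nderiv fun t => (hilb J t : ℤ)) = fun t => ((coMons J 1 t).card : ℤ) := by
    funext t
    cases t with
    | zero => simp [nderiv, card_coMons_degree_zero h0]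
    | succ t => simp [nderiv, hilb_succ hJ.1 hs]
  rw [h]
  refine ⟨fun t => Int.natCast_nonneg _, ?_, fun t ht => ?_⟩
  · simp [card_coMons_degree_zero h0]
  · simp only [Int.toNat_natCast]
    exact_mod_cast hJ.card_coMons_le_plusPlus 1 ht

/-! ### Backward differences of the Hilbert polynomial -/

/-- The backward difference `f(z) - f(z - 1)`. -/
def bdiff : (ℤ → ℤ) →+ (ℤ → ℤ) where
  toFun f := fun z => f z - f (z - 1)
  map_zero' := by funext z; simp
  map_add' f g := by funext z; simp only [Pi.add_apply]; ring

theorem bdiff_apply (f : ℤ → ℤ) (z : ℤ) : bdiff f z = f z - f (z - 1) := rfl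

theorem zchoose_pascal (a : ℤ) (k : ℕ) :
    zchoose a (k + 1) = zchoose (a - 1) k + zchoose (a - 1) (k + 1) := by
  rcases lt_trichotomy a 0 with h | rfl | h
  · obtain ⟨b, rfl⟩ : ∃ b : ℕ, a = -((b : ℤ) + 1) := ⟨(-a - 1).toNat, by omega⟩
    rw [zchoose, if_neg (by omega), zchoose, if_neg (by omega), zchoose, if_neg (by omega)]
    rw [show (((k + 1 : ℕ) : ℤ) - 1 - -((b : ℤ) + 1)).toNat = k + b + 1 by omega,
      show ((k : ℤ) - 1 - (-((b : ℤ) + 1) - 1)).toNat = k + b + 1 by omega,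
      show (((k + 1 : ℕ) : ℤ) - 1 - (-((b : ℤ) + 1) - 1)).toNat = k + b + 1 + 1 by omega,
      Nat.choose_succ_succ' (k + b + 1) k]
    push_cast
    ring
  · rw [zchoose, if_pos le_rfl, zchoose, if_neg (by omega), zchoose, if_neg (by omega)]
    rw [show ((k : ℤ) - 1 - (0 - 1)).toNat = k by omega,
      show (((k + 1 : ℕ) : ℤ) - 1 - (0 - 1)).toNat = k + 1 by omega]
    simp [pow_succ]
  · obtain ⟨b, rfl⟩ : ∃ b : ℕ, a = (b : ℤ) + 1 := ⟨(a - 1).toNat, by omega⟩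
    rw [zchoose, if_pos (by omega), zchoose, if_pos (by omega), zchoose, if_pos (by omega)]
    rw [show ((b : ℤ) + 1).toNat = b + 1 by omega, show ((b : ℤ) + 1 - 1).toNat = b by omega,
      Nat.choose_succ_succ']
    push_cast
    ring

theorem bdiff_iterate_zchoose (k : ℕ) (c : ℤ) :
    bdiff^[k + 1] (fun z => zchoose (z + c) k) = 0 := by
  induction k generalizing c with
  | zero =>
    funext z
    simp [bdiff_apply, zchoose]
  | succ k ih =>
    rw [Function.iterate_succ_apply, ← ih (c - 1)]
    congr 1
    funext z
    rw [bdiff_apply, zchoose_pascal (z + c)]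
    rw [show z + c - 1 = z + (c - 1) by ring, show z - 1 + c = z + (c - 1) by ring]
    exact add_sub_cancel_right _ _

theorem bdiff_iterate_of_le {f : ℤ → ℤ} {K L : ℕ} (h : bdiff^[K] f = 0) (hL : K ≤ L) :
    bdiff^[L] f = 0 := by
  obtain ⟨s, rfl⟩ : ∃ s, L = s + K := ⟨L - K, by omega⟩
  rw [Function.iterate_add_apply, h]
  exact iterate_map_zero bdiff s

theorem GotzmannPoly.exists_bdiff_iterate_eval (p : GotzmannPoly) :
    ∃ K, bdiff^[K] p.eval = 0 := by
  have key : ∀ N : ℕ, ∃ K, bdiff^[K]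
      (fun z => ∑ i ∈ Finset.range N, zchoose (z + (p.ks.getD i 0 : ℤ) - i) (p.ks.getD i 0)) = 0 := by
    intro N
    induction N with
    | zero => exact ⟨0, by funext z; simp⟩
    | succ N ih =>
      obtain ⟨K, hK⟩ := ih
      set k := p.ks.getD N 0
      refine ⟨max K (k + 1), ?_⟩
      have h2 := bdiff_iterate_zchoose k ((k : ℤ) - N)
      have hsum : (fun z : ℤ => ∑ i ∈ Finset.range (N + 1),
          zchoose (z + (p.ks.getD i 0 : ℤ) - i) (p.ks.getD i 0)) =
          (fun z => ∑ i ∈ Finset.range N, zchoose (z + (p.ks.getD i 0 : ℤ) - i) (p.ks.getD i 0)) +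
          fun z => zchoose (z + ((k : ℤ) - N)) k := by
        funext z
        rw [Pi.add_apply, Finset.sum_range_succ, add_sub_assoc z (k : ℤ)]
      rw [hsum, iterate_map_add, bdiff_iterate_of_le hK (le_max_left _ _),
        bdiff_iterate_of_le h2 (le_max_right _ _), add_zero]
  exact key p.r

theorem eq_of_diff_eq {a b : ℕ → ℤ} {N M : ℕ} (hd : ∀ t, M ≤ t → a (t + 1) - a t = b (t + 1) - b t)
    (he : ∀ t, N ≤ t → a t = b t) (t : ℕ) (ht : M ≤ t) : a t = b t := by
  have key : ∀ s, a (t + s) - b (t + s) = a t - b t := by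
    intro s
    induction s with
    | zero => rfl
    | succ s ih =>
      have := hd (t + s) (by omega)
      rw [← add_assoc]
      linarith
  have h1 := key N
  have h2 := he (t + N) (by omega)
  linarith

theorem StronglyStable.card_coMons_eq_bdiff {n : ℕ} {J : Set (Mon n)} (hJ : StronglyStable J)
    {d : ℕ} (hM : GenLE J (d + 1)) {f : ℤ → ℤ} {K : ℕ} (hK : bdiff^[K] f = 0)
    (hf : ∃ N : ℕ, ∀ t : ℕ, N ≤ t → (hilb J t : ℤ) = f t) (i : ℕ) :
    ∀ t : ℕ, d + 1 ≤ t → ((coMons J i t).card : ℤ) = bdiff^[i] f t := by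
  have hrec : ∀ i t : ℕ, d + 1 ≤ t → ((coMons J i (t + 1)).card : ℤ) =
      (coMons J (i + 1) (t + 1)).card + (coMons J i t).card := by
    intro i t ht
    exact_mod_cast hJ.card_coMons_succ hM i (by omega) ht
  have hbd : ∀ (i t : ℕ), bdiff^[i + 1] f ((t + 1 : ℕ) : ℤ) =
      bdiff^[i] f ((t + 1 : ℕ) : ℤ) - bdiff^[i] f (t : ℤ) := by
    intro i t
    rw [Function.iterate_succ_apply', bdiff_apply]
    rw [show ((t + 1 : ℕ) : ℤ) - 1 = t by push_cast; ring]
  have hev : ∀ i : ℕ, ∃ N : ℕ, ∀ t : ℕ, N ≤ t → ((coMons J i t).card : ℤ) = bdiff^[i] f t := by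
    intro i
    induction i with
    | zero =>
      obtain ⟨N, hN⟩ := hf
      exact ⟨N, fun t ht => by rw [← hilb_eq]; exact hN t ht⟩
    | succ i ih =>
      obtain ⟨N, hN⟩ := ih
      refine ⟨max N (d + 1) + 1, fun t ht => ?_⟩
      obtain ⟨t, rfl⟩ : ∃ s, t = s + 1 := ⟨t - 1, by omega⟩
      rw [hbd, ← hN _ (by omega), ← hN _ (by omega), hrec i t (by omega)]
      ring
  have hlarge : ∀ i : ℕ, max (n + 1) K ≤ i → ∀ t : ℕ, d + 1 ≤ t →
      ((coMons J i t).card : ℤ) = bdiff^[i] f t := by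
    intro i hi t ht
    rw [coMons_eq_empty J (by omega) (by omega), bdiff_iterate_of_le hK (by omega)]
    simp
  have hstep : ∀ i : ℕ, (∀ t : ℕ, d + 1 ≤ t → ((coMons J (i + 1) t).card : ℤ) = bdiff^[i + 1] f t) →
      ∀ t : ℕ, d + 1 ≤ t → ((coMons J i t).card : ℤ) = bdiff^[i] f t := by
    intro i hi
    obtain ⟨N, hN⟩ := hev i
    refine eq_of_diff_eq (b := fun t : ℕ => bdiff^[i] f t) (fun t ht => ?_) hN
    have h1 := hi (t + 1) (by omega)
    rw [hbd] at h1
    have h2 := hrec i t ht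
    linarith
  have hdesc : ∀ s i : ℕ, max (n + 1) K ≤ i + s → ∀ t : ℕ, d + 1 ≤ t →
      ((coMons J i t).card : ℤ) = bdiff^[i] f t := by
    intro s
    induction s with
    | zero => exact fun i hi => hlarge i hi
    | succ s ih => exact fun i hi => hstep i (ih (i + 1) (by omega))
  exact hdesc _ i (Nat.le_add_left _ _)

/-- The Hilbert function of a saturated strongly stable ideal generated in degrees at most
`d + 1` agrees with its Hilbert polynomial from degree `d` on. -/
theorem StronglyStable.hilb_eq_eval {n : ℕ} {J : Set (Mon n)} (hJ : StronglyStable J)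
    (hs : ∀ m, m + monX 0 ∈ J → m ∈ J) {d : ℕ} (hM : GenLE J (d + 1)) (p : GotzmannPoly)
    (hf : ∃ N : ℕ, ∀ t : ℕ, N ≤ t → (hilb J t : ℤ) = p.eval t) (t : ℕ) (ht : d ≤ t) :
    (hilb J t : ℤ) = p.eval t := by
  obtain ⟨K, hK⟩ := p.exists_bdiff_iterate_eval
  obtain ⟨N, hN⟩ := hf
  refine eq_of_diff_eq (a := fun t => (hilb J t : ℤ)) (b := fun t : ℕ => p.eval t)
    (fun t ht => ?_) hN t ht
  have h := hJ.card_coMons_eq_bdiff hM hK ⟨N, hN⟩ 1 (t + 1) (by omega)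
  rw [Function.iterate_one, bdiff_apply] at h
  simp only [hilb_succ hJ.1 hs]
  push_cast at h ⊢
  rw [h]
  ring_nf

theorem StronglyStable.growth_sub_eq_eval {n : ℕ} {J : Set (Mon n)} (hJ : StronglyStable J)
    {d : ℕ} (hM : GenLE J (d + 1)) (p : GotzmannPoly)
    (hf : ∃ N : ℕ, ∀ t : ℕ, N ≤ t → (hilb J t : ℤ) = p.eval t) :
    (growth J d 0 : ℤ) - growth J d 1 = p.eval ((d : ℤ) - 1) := by
  obtain ⟨K, hK⟩ := p.exists_bdiff_iterate_eval
  have h := fun i => hJ.card_coMons_eq_bdiff hM hK hf i (d + 1) le_rfl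
  have h0 := h 0
  have h1 := h 1
  have h2 := h 2
  have g : ∀ i, (growth J d i : ℤ) =
      (coMons J i (d + 1)).card - (coMons J (i + 1) (d + 1)).card := by
    intro i
    have := Finset.card_le_card (coMons_anti J (Nat.le_succ i) (d + 1))
    rw [growth]
    push_cast [this]
    rfl
  rw [g, g]
  simp only [Function.iterate_succ_apply, Function.iterate_zero, id, bdiff_apply] at h0 h1 h2
  push_cast at h0 h1 h2
  norm_num at h0 h1 h2 ⊢
  rw [h0, h1, h2]
  ring_nf

/-! ### Construction of strongly stable ideals -/

/-- The ideal generated by the monomials in `x_1, …, x_n` outside `N`. -/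
def idealAvoiding {n : ℕ} (N : Set (Mon n)) : Set (Mon n) :=
  {m | ∃ m', m' ≤ m ∧ m' 0 = 0 ∧ m' ∉ N}

theorem le_of_le_add_monX {n : ℕ} {m m' : Mon n} {l : Fin (n + 1)} (h : m' ≤ m + monX l)
    (hl : m' l = 0) : m' ≤ m := by
  intro k
  have h1 := h k
  rw [Pi.add_apply, monX_apply] at h1
  split_ifs at h1 with hk
  · rw [hk, hl]; exact Nat.zero_le _
  · omega

theorem stronglyStable_idealAvoiding {n : ℕ} {N : Set (Mon n)}
    (hN : ∀ (m : Mon n) (a b : Fin (n + 1)), 1 ≤ a.val → a < b → m + monX b ∈ N → m + monX a ∈ N) :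
    StronglyStable (idealAvoiding N) := by
  rw [stronglyStable_iff]
  refine ⟨fun m ⟨m', h1, h2⟩ c => ⟨m', h1.trans (fun k => Nat.le_add_right _ _), h2⟩,
    fun m a b hab ⟨m', h1, h2, h3⟩ => ?_⟩
  rcases Nat.eq_zero_or_pos (m' a) with h0 | hpos
  · exact ⟨m', (le_of_le_add_monX h1 h0).trans fun k => Nat.le_add_right _ _, h2, h3⟩
  · obtain ⟨c, rfl⟩ := exists_eq_add_monX hpos
    rw [Pi.add_apply] at h2
    have ha : 1 ≤ a.val := by
      rcases Nat.eq_zero_or_pos a.val with hc | hc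
      · obtain rfl : a = 0 := Fin.ext hc
        rw [monX_same] at h2
        omega
      · exact hc
    have hb : (0 : Fin (n + 1)) ≠ b := by rintro rfl; exact absurd hab (by simp)
    refine ⟨c + monX b, add_le_add_left (le_of_add_le_add_right h1) _, ?_, fun h =>
      h3 (hN c a b ha hab h)⟩
    rw [Pi.add_apply, monX_ne hb]
    omega

theorem idealAvoiding_saturated {n : ℕ} {N : Set (Mon n)} (m : Mon n)
    (h : m + monX 0 ∈ idealAvoiding N) : m ∈ idealAvoiding N := by
  obtain ⟨m', h1, h2, h3⟩ := h
  exact ⟨m', le_of_le_add_monX h1 h2, h2, h3⟩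

theorem zero_notMem_idealAvoiding {n : ℕ} {N : Set (Mon n)} (h : (0 : Mon n) ∈ N) :
    (0 : Mon n) ∉ idealAvoiding N := by
  rintro ⟨m', h1, _, h3⟩
  obtain rfl : m' = 0 := by
    funext k
    have := h1 k
    simpa using this
  exact h3 h

theorem exists_add_of_lt {n : ℕ} {m' m : Mon n} (h : m' ≤ m) (hne : m' ≠ m) :
    ∃ (c : Mon n) (l : Fin (n + 1)), m = c + monX l ∧ m' ≤ c := by
  obtain ⟨l, hl⟩ : ∃ l, m' l < m l := by
    by_contra hc
    push Not at hc
    exact hne (le_antisymm h hc)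
  obtain ⟨c, rfl⟩ := exists_eq_add_monX (m := m) (l := l) (by omega)
  refine ⟨c, l, rfl, fun k => ?_⟩
  have h1 := h k
  rw [Pi.add_apply, monX_same] at hl
  rw [Pi.add_apply, monX_apply] at h1
  split_ifs at h1 with hk
  · rw [hk]; exact Nat.le_of_lt_succ hl
  · omega

theorem genLE_idealAvoiding {n : ℕ} {N : Set (Mon n)} {M : ℕ} (hN : ∀ m, M < mdeg m → m ∈ N) :
    GenLE (idealAvoiding N) M := by
  rintro m ⟨m', h1, h2, h3⟩ hlt
  obtain ⟨c, l, rfl, hc⟩ := exists_add_of_lt h1 (by rintro rfl; exact h3 (hN _ hlt))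
  exact ⟨l, c, rfl, m', hc, h2, h3⟩

theorem mem_idealAvoiding_iff {n : ℕ} {N : Set (Mon n)} {t : ℕ}
    (hN : ∀ (m : Mon n) (l : Fin (n + 1)), 1 ≤ l.val → mdeg m < t → m + monX l ∈ N → m ∈ N)
    {m : Mon n} (h0 : m 0 = 0) (hm : mdeg m ≤ t) : m ∈ idealAvoiding N ↔ m ∉ N := by
  refine ⟨?_, fun h => ⟨m, le_rfl, h0, h⟩⟩
  rintro ⟨m', h1, h2, h3⟩ hmN
  induction hs : mdeg m generalizing m with
  | zero =>
    have := eq_zero_of_mdeg_eq_zero hs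
    subst this
    obtain rfl : m' = 0 := by
      funext k
      have := h1 k
      simpa using this
    exact h3 hmN
  | succ s ih =>
    obtain ⟨c, l, rfl, hc⟩ := exists_add_of_lt h1 (by rintro rfl; exact h3 hmN)
    rw [mdeg_add, mdeg_monX] at hs hm
    rw [Pi.add_apply] at h0
    have hl : 1 ≤ l.val := by
      rcases Nat.eq_zero_or_pos l.val with hc' | hc'
      · obtain rfl : l = 0 := Fin.ext hc'
        rw [monX_same] at h0
        omega
      · exact hc'
    exact ih (by omega) (by omega) hc (hN c l hl (by omega) hmN) (by omega)

theorem coMons_idealAvoiding {n : ℕ} {N : Set (Mon n)} {t : ℕ}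
    (hN : ∀ (m : Mon n) (l : Fin (n + 1)), 1 ≤ l.val → mdeg m < t → m + monX l ∈ N → m ∈ N)
    {i s : ℕ} (hi : 1 ≤ i) (hs : s ≤ t) (m : Mon n) :
    m ∈ coMons (idealAvoiding N) i s ↔ m ∈ monsFrom n i s ∧ m ∈ N := by
  rw [mem_coMons]
  refine and_congr_right fun h => ?_
  rw [mem_monsFrom] at h
  rw [mem_idealAvoiding_iff hN (h.2 0 (by simp; omega)) (by omega), not_not]

theorem hilb_eq_of_coMons {n : ℕ} {J : Set (Mon n)} (hJ : MonIdeal J)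
    (hs : ∀ m, m + monX 0 ∈ J → m ∈ J) (h0 : (0 : Mon n) ∉ J) {u : ℕ → ℤ} (hu : u 0 = 1)
    (hu' : ∀ t, 0 ≤ nderiv u t) {d : ℕ}
    (h : ∀ t, 1 ≤ t → t ≤ d → (coMons J 1 t).card = (nderiv u t).toNat) :
    ∀ t ≤ d, (hilb J t : ℤ) = u t := by
  intro t
  induction t with
  | zero => intro _; rw [hilb_eq, card_coMons_degree_zero h0, hu, Nat.cast_one]
  | succ t ih =>
    intro ht
    rw [hilb_succ hJ hs, h _ (by omega) ht, Nat.cast_add, ih (by omega), Int.toNat_of_nonneg (hu' _)]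
    simp [nderiv]

/-- Segments of prescribed sizes given by an O-sequence. -/
theorem OSeq.exists_segs {w : ℕ → ℤ} (hw : OSeq w) {n : ℕ} (hn : 1 ≤ n) (h1 : w 1 ≤ n) :
    ∃ S : ℕ → Finset (Mon n), (∀ t, IsSeg 1 t (S t)) ∧ (∀ t, (S t).card = (w t).toNat) ∧
      0 ∈ S 0 ∧ ∀ (m : Mon n) (l : Fin (n + 1)), 1 ≤ l.val →
        m + monX l ∈ S (mdeg m + 1) → m ∈ S (mdeg m) := by
  choose S hS hc using fun t => exists_isSeg n 1 t (hw.toNat_le_card hn h1 t)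
  have h0 : (0 : Mon n) ∈ S 0 := by
    have h2 : (S 0).card = 1 := by rw [hc, hw.2.1]; rfl
    obtain ⟨x, hx⟩ := Finset.card_eq_one.1 h2
    have h3 : x ∈ S 0 := by rw [hx]; exact Finset.mem_singleton_self x
    have h4 := (hS 0).1 h3
    rw [monsFrom_zero, Finset.mem_singleton] at h4
    rwa [h4] at h3
  refine ⟨S, hS, hc, h0, fun m l hl hm => ?_⟩
  rcases Nat.eq_zero_or_pos (mdeg m) with hm0 | hpos
  · rw [hm0, eq_zero_of_mdeg_eq_zero hm0]
    exact h0
  · refine (hS _).mem_of_add_monX_mem (by omega) (hS _) hpos ?_ hl hm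
    have := hw.2.2 _ hpos
    rw [hc, hc]
    omega

/-- Every numerical function that is admissible together with its first derivative is the Hilbert
function of a saturated strongly stable ideal. -/
theorem exists_stronglyStable_hilb_eq {u : ℕ → ℤ} (hu : OSeq u) (hu' : OSeq (nderiv u)) :
    ∃ (n : ℕ) (J : Set (Mon n)), StronglyStable J ∧ monSat J = J ∧ ∀ t, (hilb J t : ℤ) = u t := by
  obtain ⟨S, hS, hc, h0, hdiv⟩ := hu'.exists_segs (n := max (nderiv u 1).toNat 1)
    (le_max_right _ _) (by have := le_max_left (nderiv u 1).toNat 1; omega)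
  have hN : ∀ (m : Mon _) (a b : Fin _), 1 ≤ a.val → a < b →
      m + monX b ∈ {m | m ∈ S (mdeg m)} → m + monX a ∈ {m | m ∈ S (mdeg m)} := by
    intro m a b ha hab hm
    rw [Set.mem_ofPred_eq, mdeg_add, mdeg_monX] at hm ⊢
    exact (hS _).isDown.2 m a b ha hab hm
  have hJ := stronglyStable_idealAvoiding hN
  refine ⟨_, idealAvoiding {m | m ∈ S (mdeg m)}, hJ, (monSat_subset_iff hJ).2 idealAvoiding_saturated,
    fun t => hilb_eq_of_coMons hJ.1 idealAvoiding_saturated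
      (zero_notMem_idealAvoiding (by rw [Set.mem_ofPred_eq, mdeg_zero]; exact h0)) hu.2.1 hu'.1 (d := t)
      (fun t _ _ => ?_) t le_rfl⟩
  rw [← hc t]
  congr 1
  ext m
  rw [coMons_idealAvoiding (t := t) (fun m l hl _ hm => ?_) le_rfl le_rfl]
  · constructor
    · rintro ⟨h1, h2⟩
      rw [Set.mem_ofPred_eq, (mem_monsFrom.1 h1).1] at h2
      exact h2
    · intro hm
      have h1 := (hS t).1 hm
      refine ⟨h1, ?_⟩
      rw [Set.mem_ofPred_eq, (mem_monsFrom.1 h1).1]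
      exact hm
  · rw [Set.mem_ofPred_eq, mdeg_add, mdeg_monX] at hm
    exact hdiv m l hl hm

/-- The dimensions in large degrees are determined by the growth numbers. -/
theorem StronglyStable.card_coMons_congr {n n' : ℕ} {J : Set (Mon n)} {J' : Set (Mon n')}
    (hJ : StronglyStable J) (hJ' : StronglyStable J') {d : ℕ} (hM : GenLE J (d + 1))
    (hM' : GenLE J' (d + 1)) (hg : ∀ i, growth J d i = growth J' d i) :
    ∀ t, d + 1 ≤ t → ∀ i, (coMons J i t).card = (coMons J' i t).card := by
  intro t ht
  have hdesc : ∀ t, 1 ≤ t → (∀ i, (coMons J (i + 1) t).card = (coMons J' (i + 1) t).card →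
      (coMons J i t).card = (coMons J' i t).card) →
      ∀ i, (coMons J i t).card = (coMons J' i t).card := by
    intro t ht hstep
    have key : ∀ s i, n + n' + 1 ≤ i + s → (coMons J i t).card = (coMons J' i t).card := by
      intro s
      induction s with
      | zero =>
        intro i hi
        rw [coMons_eq_empty J (by omega) ht, coMons_eq_empty J' (by omega) ht]
        rfl
      | succ s ih => exact fun i hi => hstep i (ih (i + 1) (by omega))
    exact fun i => key (n + n' + 1) i (by omega)
  induction t, ht using Nat.le_induction with
  | base =>
    refine hdesc _ (by omega) fun i hi => ?_
    have h1 := hg i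
    have h2 := Finset.card_le_card (coMons_anti J (Nat.le_succ i) (d + 1))
    have h3 := Finset.card_le_card (coMons_anti J' (Nat.le_succ i) (d + 1))
    rw [growth, growth] at h1
    simp only [Nat.succ_eq_add_one] at h2 h3
    omega
  | succ t ht ih =>
    refine hdesc _ (by omega) fun i hi => ?_
    rw [hJ.card_coMons_succ hM i (by omega) ht, hJ'.card_coMons_succ hM' i (by omega) ht, hi, ih i]

/-- A decreasing chain of segments of prescribed sizes. -/
theorem exists_chain_segs {n d : ℕ} {g : ℕ → ℕ} (h1 : g 1 ≤ (monsFrom n 1 d).card)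
    (hstep : ∀ i, 1 ≤ i → g (i + 1) + minusMinus (g i) d ≤ g i) (hz : ∀ i, n < i → g i = 0) :
    ∃ I : ℕ → Finset (Mon n), (∀ i, 1 ≤ i → IsSeg i d (I i) ∧ (I i).card = g i) ∧
      ∀ i j, 1 ≤ i → i ≤ j → I j ⊆ I i := by
  have hcard : ∀ i, 1 ≤ i → g i ≤ (monsFrom n i d).card := by
    intro i hi
    induction i, hi using Nat.le_induction with
    | base => exact h1
    | succ i hi ih =>
      rcases Nat.lt_or_ge i (n + 1) with hn | hn
      · obtain ⟨A, hA, hAc⟩ := exists_isSeg n i d ih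
        have e1 := card_eq_free_add_colon ⟨i, hn⟩ A
        have e2 := hA.card_colon hn
        have e3 := Finset.card_le_card (hA.free hn).1
        have e4 := hstep i hi
        rw [hAc] at e1 e2
        omega
      · rw [hz (i + 1) (by omega)]
        exact Nat.zero_le _
  have hex : ∀ i, ∃ A : Finset (Mon n), 1 ≤ i → IsSeg i d A ∧ A.card = g i := by
    intro i
    rcases Nat.lt_or_ge i 1 with hi | hi
    · exact ⟨∅, fun h => absurd h (by omega)⟩
    · obtain ⟨A, hA⟩ := exists_isSeg n i d (hcard i hi)
      exact ⟨A, fun _ => hA⟩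
  choose I hI using hex
  refine ⟨I, hI, fun i j hi hij => ?_⟩
  induction j, hij using Nat.le_induction with
  | base => exact Finset.Subset.refl _
  | succ j hij ih =>
    refine Finset.Subset.trans ?_ ih
    have hj : 1 ≤ j := by omega
    rcases Nat.lt_or_ge j (n + 1) with hn | hn
    · refine (hI j hj).1.subset_of_succ hn (hI (j + 1) (by omega)).1 ?_
      rw [(hI j hj).2, (hI (j + 1) (by omega)).2]
      exact hstep j hj
    · have := (hI (j + 1) (by omega)).2
      rw [hz (j + 1) (by omega), Finset.card_eq_zero] at this
      rw [this]
      exact Finset.empty_subset _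

/-- The terms of degree `d + 1` obtained by gluing a chain of segments. -/
def gluedTerms {n : ℕ} (I : ℕ → Finset (Mon n)) : Set (Mon n) :=
  {m | ∃ (i : Fin (n + 1)) (m' : Mon n), 1 ≤ i.val ∧ m = m' + monX i ∧ m' ∈ I i.val}

theorem le_of_add_monX_mem_monsFrom {n i d : ℕ} {c : Mon n} {b : Fin (n + 1)}
    (h : c + monX b ∈ monsFrom n i d) : i ≤ b.val := by
  by_contra hc
  have := (mem_monsFrom.1 h).2 b (by omega)
  rw [Pi.add_apply, monX_same] at this
  omega

section Glue

variable {n d : ℕ} {I : ℕ → Finset (Mon n)}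

theorem gluedTerms_down (hI : ∀ i, 1 ≤ i → IsDown i d (I i))
    (hanti : ∀ i j, 1 ≤ i → i ≤ j → I j ⊆ I i) {m : Mon n} {a b : Fin (n + 1)} (ha : 1 ≤ a.val)
    (hab : a < b) (h : m + monX b ∈ gluedTerms I) : m + monX a ∈ gluedTerms I := by
  obtain ⟨i, m', hi, heq, hm'⟩ := h
  by_cases hib : i = b
  · subst hib
    obtain rfl : m = m' := add_right_cancel heq
    exact ⟨a, m, ha, rfl, hanti _ _ ha (Fin.lt_def.1 hab).le hm'⟩
  · obtain ⟨c, rfl, rfl⟩ := exists_common_of_add_monX_eq hib heq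
    rcases le_or_gt i a with hia | hia
    · exact ⟨i, c + monX a, hi, add_right_comm _ _ _,
        (hI _ hi).2 c a b (Fin.le_def.1 hia) hab hm'⟩
    · have hib' : i < b :=
        lt_of_le_of_ne (le_of_add_monX_mem_monsFrom ((hI _ hi).1 hm')) hib
      exact ⟨a, c + monX i, ha, rfl, hanti _ _ ha (Fin.lt_def.1 hia).le
        ((hI _ hi).2 c i b le_rfl hib' hm')⟩

theorem mem_of_add_mem_gluedTerms (hI : ∀ i, 1 ≤ i → IsDown i d (I i)) {m : Mon n}
    {l : Fin (n + 1)} (h : m + monX l ∈ gluedTerms I) : ∃ i, 1 ≤ i ∧ m ∈ I i := by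
  obtain ⟨i, m', hi, heq, hm'⟩ := h
  refine ⟨i, hi, ?_⟩
  by_cases hil : i = l
  · subst hil
    obtain rfl : m = m' := add_right_cancel heq
    exact hm'
  · obtain ⟨c, rfl, rfl⟩ := exists_common_of_add_monX_eq hil heq
    exact (hI _ hi).2 c i l le_rfl
      (lt_of_le_of_ne (le_of_add_monX_mem_monsFrom ((hI _ hi).1 hm')) hil) hm'

theorem add_monX_mem_gluedTerms_iff (hI : ∀ i, 1 ≤ i → IsDown i d (I i)) {m : Mon n} {i : Fin (n + 1)} (hi : 1 ≤ i.val)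
    (hm : m ∈ monsFrom n i.val d) : m + monX i ∈ gluedTerms I ↔ m ∈ I i.val := by
  refine ⟨fun h => ?_, fun h => ⟨i, m, hi, rfl, h⟩⟩
  obtain ⟨j, m', hj, heq, hm'⟩ := h
  have hij : i.val ≤ j.val := by
    have h1 := (add_monX_mem_monsFrom (n := n) (i := i.val) (l := i) le_rfl).2 hm
    rw [heq] at h1
    exact le_of_add_monX_mem_monsFrom h1
  by_cases hji : j = i
  · subst hji
    obtain rfl : m = m' := add_right_cancel heq
    exact hm'
  · obtain ⟨c, rfl, rfl⟩ := exists_common_of_add_monX_eq hji heq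
    exact absurd (le_antisymm (le_of_add_monX_mem_monsFrom ((hI _ hj).1 hm')) hij)
      fun h => hji (Fin.ext h)

end Glue

/-- The transfer principle: a numerical function agreeing with the Hilbert function of `J` from
degree `d` on, and small enough in degree `d - 1`, is realized with regularity at most `d + 1`. -/
theorem exists_genLE_of_growth {n d : ℕ} {Jv : Set (Mon n)} (hJv : StronglyStable Jv)
    (hs : ∀ m, m + monX 0 ∈ Jv → m ∈ Jv) (hM : GenLE Jv (d + 1)) (hd : 1 ≤ d) {u : ℕ → ℤ}
    (hu : OSeq u) (hu' : OSeq (nderiv u)) (huv : ∀ t, d ≤ t → (hilb Jv t : ℤ) = u t)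
    (hgr : u (d - 1) ≤ (growth Jv d 0 : ℤ) - growth Jv d 1) :
    ∃ (n' : ℕ) (J : Set (Mon n')), StronglyStable J ∧ monSat J = J ∧
      (∀ t, (hilb J t : ℤ) = u t) ∧ GenLE J (d + 1) := by
  obtain ⟨n', hn1, hnn, hnu⟩ : ∃ n' : ℕ, 1 ≤ n' ∧ n ≤ n' ∧ nderiv u 1 ≤ n' :=
    ⟨n + 1 + (nderiv u 1).toNat, by omega, by omega, by omega⟩
  obtain ⟨S, hS, hSc, hS0, hSdiv⟩ := hu'.exists_segs hn1 hnu
  have hg0 : (growth Jv d 0 : ℤ) = u d := by rw [growth_zero hJv.1 hs, huv d le_rfl]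
  have hud : nderiv u d = u d - u (d - 1) := by
    obtain ⟨e, rfl⟩ : ∃ e, d = e + 1 := ⟨d - 1, by omega⟩
    rfl
  have hg1 : growth Jv d 1 ≤ (S d).card := by
    rw [hSc]
    omega
  obtain ⟨I, hI, hanti⟩ := exists_chain_segs (n := n') (d := d) (g := growth Jv d)
    (hg1.trans (Finset.card_le_card (hS d).1)) (fun i _ => hJv.growth_succ d i)
    fun i hi => growth_eq_zero Jv d (by omega)
  have hID : ∀ i, 1 ≤ i → IsDown i d (I i) := fun i hi => (hI i hi).1.isDown
  have hIS : ∀ i, 1 ≤ i → I i ⊆ S d := fun i hi => (hanti 1 i le_rfl hi).trans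
    ((hI 1 le_rfl).1.subset_of_card_le (hS d) (by rw [(hI 1 le_rfl).2]; exact hg1))
  set N : Set (Mon n') :=
    {m | (mdeg m ≤ d → m ∈ S (mdeg m)) ∧ (mdeg m = d + 1 → m ∈ gluedTerms I)} with hNdef
  have hNlow : ∀ m, mdeg m ≤ d → (m ∈ N ↔ m ∈ S (mdeg m)) := by
    intro m hm
    rw [hNdef, Set.mem_ofPred_eq]
    exact ⟨fun h => h.1 hm, fun h => ⟨fun _ => h, fun h' => absurd h' (by omega)⟩⟩
  have hNtop : ∀ m, mdeg m = d + 1 → (m ∈ N ↔ m ∈ gluedTerms I) := by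
    intro m hm
    rw [hNdef, Set.mem_ofPred_eq]
    exact ⟨fun h => h.2 hm, fun h => ⟨fun h' => absurd h' (by omega), fun _ => h⟩⟩
  have hNhigh : ∀ m, d + 1 < mdeg m → m ∈ N := by
    intro m hm
    rw [hNdef, Set.mem_ofPred_eq]
    exact ⟨fun h' => absurd h' (by omega), fun h' => absurd h' (by omega)⟩
  have hNdown : ∀ (m : Mon n') (a b : Fin (n' + 1)), 1 ≤ a.val → a < b → m + monX b ∈ N →
      m + monX a ∈ N := by
    intro m a b ha hab hm
    have hb : mdeg (m + monX b) = mdeg m + 1 := by rw [mdeg_add, mdeg_monX]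
    have ha' : mdeg (m + monX a) = mdeg m + 1 := by rw [mdeg_add, mdeg_monX]
    rcases lt_trichotomy (mdeg m) d with h | h | h
    · rw [hNlow _ (by omega), hb] at hm
      rw [hNlow _ (by omega), ha']
      exact (hS _).isDown.2 m a b ha hab hm
    · rw [hNtop _ (by omega)] at hm ⊢
      exact gluedTerms_down hID hanti ha hab hm
    · exact hNhigh _ (by omega)
  have hNdiv : ∀ (m : Mon n') (l : Fin (n' + 1)), 1 ≤ l.val → mdeg m < d + 1 → m + monX l ∈ N →
      m ∈ N := by
    intro m l hl hlt hm
    have hml : mdeg (m + monX l) = mdeg m + 1 := by rw [mdeg_add, mdeg_monX]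
    rw [hNlow _ (by omega)]
    rcases Nat.lt_or_ge (mdeg m) d with h | h
    · rw [hNlow _ (by omega), hml] at hm
      exact hSdiv m l hl hm
    · rw [hNtop _ (by omega)] at hm
      obtain ⟨i, hi, hmi⟩ := mem_of_add_mem_gluedTerms hID hm
      rw [show mdeg m = d by omega]
      exact hIS i hi hmi
  have hJ := stronglyStable_idealAvoiding hNdown
  have h0 : (0 : Mon n') ∉ idealAvoiding N := zero_notMem_idealAvoiding (by
    rw [hNlow _ (by rw [mdeg_zero]; omega), mdeg_zero]; exact hS0)
  have hGen : GenLE (idealAvoiding N) (d + 1) := genLE_idealAvoiding hNhigh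
  have hlow := hilb_eq_of_coMons hJ.1 idealAvoiding_saturated h0 hu.2.1 hu'.1 (d := d) (by
    intro t _ ht
    rw [← hSc t]
    congr 1
    ext m
    rw [coMons_idealAvoiding hNdiv le_rfl (by omega)]
    constructor
    · rintro ⟨h1, h2⟩
      have h3 := (mem_monsFrom.1 h1).1
      rwa [hNlow m (by omega), h3] at h2
    · intro hm
      have h1 := (hS t).1 hm
      have h3 := (mem_monsFrom.1 h1).1
      refine ⟨h1, ?_⟩
      rwa [hNlow m (by omega), h3])
  have hgrowth : ∀ i, growth (idealAvoiding N) d i = growth Jv d i := by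
    intro i
    rcases Nat.eq_zero_or_pos i with rfl | hi
    · have h1 := hlow d le_rfl
      rw [← hg0, ← growth_zero hJ.1 idealAvoiding_saturated] at h1
      exact_mod_cast h1
    · rcases Nat.lt_or_ge i (n' + 1) with hin | hin
      · rw [growth_eq _ d hin, ← (hI i hi).2]
        congr 1
        ext m
        rw [mem_colon, coMons_idealAvoiding hNdiv hi le_rfl,
          add_monX_mem_monsFrom (i := i) (l := ⟨i, hin⟩) le_rfl]
        have hdeg : m ∈ monsFrom n' i d → mdeg (m + monX ⟨i, hin⟩) = d + 1 := fun h => by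
          rw [mdeg_add, mdeg_monX, (mem_monsFrom.1 h).1]
        constructor
        · rintro ⟨h1, h2⟩
          rw [hNtop _ (hdeg h1)] at h2
          exact (add_monX_mem_gluedTerms_iff hID (i := ⟨i, hin⟩) hi h1).1 h2
        · intro hm
          have h1 := (hID i hi).1 hm
          refine ⟨h1, ?_⟩
          rw [hNtop _ (hdeg h1)]
          exact (add_monX_mem_gluedTerms_iff hID (i := ⟨i, hin⟩) hi h1).2 hm
      · rw [growth_eq_zero _ d (by omega), growth_eq_zero _ d (by omega)]
  refine ⟨n', idealAvoiding N, hJ, (monSat_subset_iff hJ).2 idealAvoiding_saturated, fun t => ?_,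
    hGen⟩
  rcases Nat.lt_or_ge d t with ht | ht
  · rw [← huv t ht.le, hilb_eq, hilb_eq, hJ.card_coMons_congr hJv hGen hM hgrowth t ht 0]
  · exact hlow t ht

/-! ### Minimal functions -/

theorem one_le_minusMinus {a : ℕ} (h : 1 ≤ a) (t : ℕ) : 1 ≤ minusMinus a (t + 1) := by
  have h1 := minusMinus_mono (t + 1) h
  rwa [minusMinus_one] at h1

theorem minusMinus_le_self (a t : ℕ) : minusMinus a t ≤ a := by
  induction t generalizing a with
  | zero => simp [minusMinus]
  | succ t ih =>
    rcases Nat.eq_zero_or_pos a with rfl | ha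
    · rw [minusMinus_zero]
    · obtain ⟨k, r, htk, hr, rfl⟩ := exists_binomial_top (a := a) (by omega) t
      rw [minusMinus_choose_add htk hr, Nat.choose_succ_succ]
      have := ih r
      omega

theorem fmin_of_le (p : GotzmannPoly) {ρ t : ℕ} (h : ρ ≤ t) : fmin p ρ t = p.eval t := by
  rw [fmin, dif_pos h]

theorem fmin_of_lt (p : GotzmannPoly) {ρ t : ℕ} (h : t < ρ) :
    fmin p ρ t = (minusMinus (fmin p ρ (t + 1)).toNat (t + 1) : ℤ) := by
  rw [fmin, dif_neg (by omega)]

theorem OSeq.one_le_of_nderiv {u : ℕ → ℤ} (hu : OSeq u) (hu' : OSeq (nderiv u)) (t : ℕ) :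
    1 ≤ u t := by
  induction t with
  | zero => rw [hu.2.1]
  | succ t ih =>
    have := hu'.1 (t + 1)
    rw [nderiv] at this
    omega

theorem OSeq.minusMinus_le {u : ℕ → ℤ} (hu : OSeq u) {t : ℕ} (ht : 1 ≤ t) :
    (minusMinus (u (t + 1)).toNat (t + 1) : ℤ) ≤ u t := by
  have h1 := hu.2.2 t ht
  have h2 := hu.1 t
  have h3 : (u (t + 1)).toNat ≤ plusPlus (u t).toNat t := by omega
  rw [le_plusPlus_iff ht] at h3
  omega

theorem oSeq_succ_of_minusMinus_le {a b : ℤ} {t : ℕ} (ht : 1 ≤ t)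
    (h : (minusMinus b.toNat (t + 1) : ℤ) ≤ a) : b ≤ (plusPlus a.toNat t : ℤ) := by
  have h1 : minusMinus b.toNat (t + 1) ≤ a.toNat := by omega
  rw [← le_plusPlus_iff ht] at h1
  omega

section Minimal

variable {p : GotzmannPoly} {ρ : ℕ} {u : ℕ → ℤ}

theorem fmin_eq_of_le (hu : u ∈ Fset p ρ) {t : ℕ} (ht : ρ ≤ t) : fmin p ρ t = u t := by
  rw [fmin_of_le p ht, hu.2.2.1 t ht]

theorem one_le_fmin (hu : u ∈ Fset p ρ) (t : ℕ) : 1 ≤ fmin p ρ t := by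
  induction hk : ρ - t generalizing t with
  | zero =>
    rw [fmin_eq_of_le hu (by omega)]
    exact hu.1.one_le_of_nderiv hu.2.1 _
  | succ k ih =>
    rw [fmin_of_lt p (by omega)]
    have h1 := ih (t + 1) (by omega)
    have := one_le_minusMinus (a := (fmin p ρ (t + 1)).toNat) (by omega) t
    exact_mod_cast this

theorem fmin_zero (hu : u ∈ Fset p ρ) : fmin p ρ 0 = 1 := by
  rcases Nat.eq_zero_or_pos ρ with rfl | h
  · rw [fmin_eq_of_le hu le_rfl, hu.1.2.1]
  · have h1 := one_le_fmin hu 1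
    rw [fmin_of_lt p h, minusMinus, if_neg (by rw [zero_add]; omega)]
    simp [minusMinus]

theorem fmin_le (hu : u ∈ Fset p ρ) (t : ℕ) : fmin p ρ t ≤ u t := by
  induction hk : ρ - t generalizing t with
  | zero => rw [fmin_eq_of_le hu (by omega)]
  | succ k ih =>
    rcases Nat.eq_zero_or_pos t with rfl | hpos
    · rw [fmin_zero hu, hu.1.2.1]
    · rw [fmin_of_lt p (by omega)]
      have h2 := hu.1.minusMinus_le hpos
      have h3 := minusMinus_mono (t + 1) (Int.toNat_le_toNat (ih (t + 1) (by omega)))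
      omega

theorem oSeq_fmin (hu : u ∈ Fset p ρ) : OSeq (fmin p ρ) := by
  refine ⟨fun t => by have := one_le_fmin hu t; omega, fmin_zero hu, fun t ht => ?_⟩
  refine oSeq_succ_of_minusMinus_le ht ?_
  rcases Nat.lt_or_ge t ρ with h | h
  · rw [← fmin_of_lt p h]
  · rw [fmin_eq_of_le hu h, fmin_eq_of_le hu (by omega)]
    exact hu.1.minusMinus_le ht

theorem oSeq_nderiv_fmin (hu : u ∈ Fset p ρ) : OSeq (nderiv (fmin p ρ)) := by
  refine ⟨fun t => ?_, rfl, fun t ht => oSeq_succ_of_minusMinus_le ht ?_⟩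
  · rcases t with _ | t
    · simp [nderiv]
    · rw [nderiv]
      rcases Nat.lt_or_ge t ρ with h | h
      · rw [fmin_of_lt p h]
        have h1 := minusMinus_le_self (fmin p ρ (t + 1)).toNat (t + 1)
        have h2 := one_le_fmin hu (t + 1)
        omega
      · rw [fmin_eq_of_le hu h, fmin_eq_of_le hu (by omega)]
        exact hu.2.1.1 (t + 1)
  · obtain ⟨s, rfl⟩ : ∃ s, t = s + 1 := ⟨t - 1, by omega⟩
    rw [nderiv, nderiv]
    rcases Nat.lt_or_ge (s + 1) ρ with h | h
    · have h1 := one_le_fmin hu (s + 1 + 1)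
      have h2 := minusMinus_sub_le (fmin p ρ (s + 1 + 1)).toNat (s + 1)
      have h3 := minusMinus_le_self (fmin p ρ (s + 1 + 1)).toNat (s + 1 + 1)
      have h4 := minusMinus_le_self (minusMinus (fmin p ρ (s + 1 + 1)).toNat (s + 1 + 1)) (s + 1)
      rw [fmin_of_lt p (show s < ρ by omega), fmin_of_lt p h, Int.toNat_natCast]
      rw [show (fmin p ρ (s + 1 + 1) - (minusMinus (fmin p ρ (s + 1 + 1)).toNat (s + 1 + 1) : ℤ)).toNat
        = (fmin p ρ (s + 1 + 1)).toNat - minusMinus (fmin p ρ (s + 1 + 1)).toNat (s + 1 + 1) by omega]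
      omega
    · rw [fmin_eq_of_le hu h, fmin_eq_of_le hu (show ρ ≤ s + 1 + 1 by omega)]
      have h1 := hu.2.1.minusMinus_le ht
      have h2 := fmin_le hu s
      rw [nderiv, nderiv] at h1
      omega

theorem mem_Fset_of_hasHP {w : ℕ → ℤ} (hw : OSeq w) (hw' : OSeq (nderiv w)) {N : ℕ}
    (h : ∀ t : ℕ, N ≤ t → w t = p.eval t) : ∃ ρ' ≤ N, w ∈ Fset p ρ' := by
  have hex : ∃ N : ℕ, ∀ t : ℕ, N ≤ t → w t = p.eval t := ⟨N, h⟩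
  exact ⟨Nat.find hex, Nat.find_min' hex h, hw, hw', Nat.find_spec hex,
    fun ρ' h' => Nat.find_min' hex h'⟩

theorem fmin_rhobar_mem (hu : u ∈ Fset p (rhobar p)) :
    fmin p (rhobar p) ∈ Fset p (rhobar p) := by
  obtain ⟨ρ', hle, hmem⟩ := mem_Fset_of_hasHP (oSeq_fmin hu) (oSeq_nderiv_fmin hu)
    (fun t ht => fmin_of_le p ht)
  have h : rhobar p ≤ ρ' := Nat.sInf_le ⟨_, hmem⟩
  rwa [le_antisymm hle h] at hmem

end Minimal

/-! ### Minimal Castelnuovo–Mumford regularities -/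

theorem mReg_le_of_genLE {u : ℕ → ℤ} {n M : ℕ} {J : Set (Mon n)} (hJ : StronglyStable J)
    (hs : monSat J = J) (hu : ∀ t, (hilb J t : ℤ) = u t) (hM : GenLE J M) : mReg u ≤ M :=
  (show mReg u ≤ monReg J from Nat.sInf_le ⟨n, J, hJ, hs, hu, rfl⟩).trans hM.monReg_le

theorem exists_genLE_mReg {u : ℕ → ℤ} (hu : OSeq u) (hu' : OSeq (nderiv u)) :
    ∃ (n : ℕ) (J : Set (Mon n)), StronglyStable J ∧ (∀ m, m + monX 0 ∈ J → m ∈ J) ∧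
      (∀ t, (hilb J t : ℤ) = u t) ∧ GenLE J (mReg u) := by
  obtain ⟨n, J, hJ, hs, hh⟩ := exists_stronglyStable_hilb_eq hu hu'
  have hmem : mReg u ∈ {r | ∃ (n : ℕ) (J : Set (Mon n)), StronglyStable J ∧ monSat J = J ∧
      (∀ t : ℕ, (hilb J t : ℤ) = u t) ∧ monReg J = r} :=
    Nat.sInf_mem ⟨_, n, J, hJ, hs, hh, rfl⟩
  obtain ⟨n, J, hJ, hs, hh, hr⟩ := hmem
  exact ⟨n, J, hJ, (monSat_subset_iff hJ).1 hs, hh, hr ▸ hJ.1.genLE_monReg⟩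

/-- Comparison of minimal regularities. -/
theorem mReg_le_mReg {p : GotzmannPoly} {ρ ρ' : ℕ} {u v : ℕ → ℤ} (hu : u ∈ Fset p ρ)
    (hv : v ∈ Fset p ρ') (hpos : 1 ≤ ρ') (hle : ρ ≤ ρ') (huv : ρ = ρ' → ∀ t, u t ≤ v t) :
    mReg u ≤ mReg v := by
  obtain ⟨n, J, hJ, hs, hh, hM⟩ := exists_genLE_mReg hv.1 hv.2.1
  obtain ⟨d, hd⟩ : ∃ d, d = mReg v - 1 := ⟨_, rfl⟩
  have hM' : GenLE J (d + 1) := hM.mono (by omega)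
  have hHP : ∃ N : ℕ, ∀ t : ℕ, N ≤ t → (hilb J t : ℤ) = p.eval t :=
    ⟨ρ', fun t ht => by rw [hh, hv.2.2.1 t ht]⟩
  have hvp := hJ.hilb_eq_eval hs hM' p hHP
  have hρd : ρ' ≤ d := hv.2.2.2 d fun t ht => by rw [← hh, hvp t ht]
  have hgr := hJ.growth_sub_eq_eval hM' p hHP
  obtain ⟨n', J', hJ', hs', hh', hG⟩ := exists_genLE_of_growth hJ hs hM' (by omega) hu.1 hu.2.1
    (fun t ht => by rw [hvp t ht, hu.2.2.1 t (by omega)]) (by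
      obtain ⟨e, rfl⟩ : ∃ e, d = e + 1 := ⟨d - 1, by omega⟩
      rw [Nat.add_sub_cancel]
      rcases Nat.lt_or_ge e ρ with h | h
      · have h1 := huv (by omega) e
        have h2 := hilb_add_growth_le hJ.1 hs e
        have h3 := hh e
        omega
      · rw [hgr, hu.2.2.1 e h]
        push_cast
        rw [add_sub_cancel_right])
  have := mReg_le_of_genLE hJ' hs' hh' hG
  omega

theorem mReg_eval_eq_zero {p : GotzmannPoly} (h : ∀ ρ, Fset p ρ = ∅) {w : ℕ → ℤ}
    (hw : ∀ t : ℕ, w t = p.eval t) : mReg w = 0 := by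
  rw [mReg, Nat.sInf_eq_zero]
  refine or_iff_not_imp_right.2 fun hne => ?_
  obtain ⟨r, n, J, hJ, hs, hh, -⟩ := Set.nonempty_iff_ne_empty.2 hne
  have hhw : (fun t => (hilb J t : ℤ)) = w := funext hh
  by_cases h0 : (0 : Mon n) ∈ J
  · refine ⟨n, J, hJ, hs, hh, Nat.le_zero.1 (GenLE.monReg_le fun m _ hlt => ?_)⟩
    obtain ⟨l, hl⟩ := exists_pos_of_mdeg_pos hlt
    obtain ⟨c, rfl⟩ := exists_eq_add_monX hl
    refine ⟨l, c, rfl, ?_⟩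
    have := hJ.1 0 h0 c
    rwa [zero_add] at this
  · have h1 := hJ.oSeq_hilb h0
    have h2 := hJ.oSeq_nderiv_hilb ((monSat_subset_iff hJ).1 hs) h0
    rw [hhw] at h1 h2
    obtain ⟨ρ, -, hρ⟩ := mem_Fset_of_hasHP (p := p) h1 h2 (N := 0) fun t _ => hw t
    rw [h ρ] at hρ
    exact absurd hρ (Set.notMem_empty _)

/-- Theorem `primo teorema`.
Let `u ∈ F(p,ρ)` and `v ∈ F(p,ρ')`. If `ρ < ρ'` then `m_u ≤ m_v`; in particular
`m^ρ_p ≤ m^{ρ'}_p`. Consequently `m_p = m̄ = m_{f^{ρ̄_p}_p}`. -/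
theorem statement17 (p : GotzmannPoly) (hr : 1 < p.r) :
    (∀ (ρ ρ' : ℕ) (u v : ℕ → ℤ), u ∈ Fset p ρ → v ∈ Fset p ρ' → ρ < ρ' →
      mReg u ≤ mReg v ∧ mRho p ρ ≤ mRho p ρ') ∧
    mP p = mReg (fmin p (rhobar p)) := by
  have hmono : ∀ (ρ ρ' : ℕ) (u v : ℕ → ℤ), u ∈ Fset p ρ → v ∈ Fset p ρ' → ρ < ρ' →
      mReg u ≤ mReg v := fun ρ ρ' u v hu hv hlt =>
    mReg_le_mReg hu hv (by omega) hlt.le fun h => absurd h hlt.ne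
  refine ⟨fun ρ ρ' u v hu hv hlt => ⟨hmono ρ ρ' u v hu hv hlt, ?_⟩, ?_⟩
  · have hmem : mRho p ρ' ∈ Mset p ρ' := Nat.sInf_mem ⟨_, v, hv, rfl⟩
    obtain ⟨v', hv', he⟩ := hmem
    rw [← he]
    exact (Nat.sInf_le ⟨u, hu, rfl⟩ : mRho p ρ ≤ mReg u).trans (hmono ρ ρ' u v' hu hv' hlt)
  · by_cases hne : {ρ | (Fset p ρ).Nonempty}.Nonempty
    · have hmem : rhobar p ∈ {ρ | (Fset p ρ).Nonempty} := Nat.sInf_mem hne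
      obtain ⟨w, hw⟩ := hmem
      have hf := fmin_rhobar_mem hw
      refine le_antisymm (Nat.sInf_le ⟨_, _, hf, rfl⟩) ?_
      have hmem : mP p ∈ {r | ∃ ρ : ℕ, ∃ u ∈ Fset p ρ, mReg u = r} :=
        Nat.sInf_mem ⟨_, _, _, hf, rfl⟩
      obtain ⟨ρ, u, hu, he⟩ := hmem
      rw [← he]
      have hle : rhobar p ≤ ρ := Nat.sInf_le ⟨u, hu⟩
      rcases Nat.eq_zero_or_pos ρ with rfl | hpos
      · obtain h0 : rhobar p = 0 := by omega
        rw [show fmin p (rhobar p) = u from funext fun t => by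
          rw [h0]; exact fmin_eq_of_le hu (Nat.zero_le t)]
      · refine mReg_le_mReg hf hu hpos hle fun h t => ?_
        rw [h]
        exact fmin_le hu t
    · rw [Set.not_nonempty_iff_eq_empty] at hne
      have hall : ∀ ρ, Fset p ρ = ∅ := fun ρ => Set.not_nonempty_iff_eq_empty.1 fun h => by
        have : ρ ∈ {ρ | (Fset p ρ).Nonempty} := h
        rw [hne] at this
        exact this
      have h0 : rhobar p = 0 := by rw [rhobar, hne, Nat.sInf_empty]
      rw [h0, mReg_eval_eq_zero hall fun t => fmin_of_le p (Nat.zero_le t), mP]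
      simp [hall]
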